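/- For every D ≥ 1 and every ε > 0 one has Σ |ω(r,s,s₀)|·|𝔊_{s²y³}|·|σ_∞(ε)| / (S·|Y|^{3/2}·s₀²) ≪_ε D^{−1/4+ε}, where the sum is over all r, s ∈ ℕ⁴, s₀ ∈ ℕ, all sign vectors ε ∈ {±1}⁴, and all y ∈ (ℤ\{0})⁴ with each y_i squarefree, sgn(y_i) = ε_i, r_i | y_i for all i, Y = y₁y₂y₃y₄ not a perfect square and |Y| > D. In particular E₁(D) = Σ ω(r,s,s₀)·𝔊_{s²y³}·σ_∞(ε)/(S·|Y|^{3/2}·s₀²) over the same range converges absolutely and satisfies E₁(D) = O_ε(D^{−1/4+ε}). -/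

import Mathlib

open scoped BigOperators
open MeasureTheory Filter

attribute [local instance 0] Classical.propDecidable

noncomputable section

/-- `e(t) = exp(2πit)`. -/
def eC (t : ℝ) : ℂ := Complex.exp (2 * Real.pi * Complex.I * t)

/-- A nonzero integer `z` is squareful if `p² ∣ z` for every prime `p` dividing `z`. -/
def Squareful (z : ℤ) : Prop := ∀ p : ℕ, p.Prime → (p : ℤ) ∣ z → (p : ℤ) ^ 2 ∣ z

/-- The standard bump function in one variable. -/
def psi1 (t : ℝ) : ℝ := if |t| < 1 then Real.exp (-(1 - t ^ 2)⁻¹) else 0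

/-- The smooth weight `w₁`. -/
def w1 (η : ℝ) (x : Fin 4 → ℝ) : ℝ :=
  if ‖x‖ ≤ η then 0
  else if ‖x‖ ≤ 2 * η then Real.exp 1 * psi1 (‖x‖ / η - 2)
  else if ‖x‖ ≤ 1 - η then 1
  else if ‖x‖ ≤ 1 then Real.exp 1 * psi1 (‖x‖ / η - (1 - η) / η)
  else 0

/-- The smooth weight `w₂`. -/
def w2 (η : ℝ) (x : Fin 4 → ℝ) : ℝ :=
  if ‖x‖ ≤ η then 0
  else if ‖x‖ ≤ 2 * η then Real.exp 1 * psi1 (‖x‖ / η - 2)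
  else if ‖x‖ ≤ 1 then 1
  else if ‖x‖ ≤ 1 + η then Real.exp 1 * psi1 (‖x‖ / η - 1 / η)
  else 0

/-- `u(t) = c₀ ψ₁(4t - 3)`, normalised so that `∫ u = 1`. -/
def uFn (t : ℝ) : ℝ := (∫ s : ℝ, psi1 (4 * s - 3))⁻¹ * psi1 (4 * t - 3)

/-- Heath-Brown's function `h(x, y)`. -/
def hFn (x y : ℝ) : ℝ :=
  ∑' j : ℕ, (x * ((j : ℝ) + 1))⁻¹ *
    (uFn (x * ((j : ℝ) + 1)) - uFn (|y| / (x * ((j : ℝ) + 1))))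

/-- The exponential sum `S_{q,a}(c)`. -/
def Sqa (a c : Fin 4 → ℤ) (q : ℕ) : ℂ :=
  ∑ k ∈ (Finset.range q).filter fun k => Nat.gcd k q = 1,
    ∑ b ∈ Fintype.piFinset fun _ : Fin 4 => Finset.range q,
      eC (((((k : ℤ) * (∑ i, a i * (b i : ℤ) ^ 2) + ∑ i, (b i : ℤ) * c i) : ℤ) : ℝ) / (q : ℝ))

/-- Partial sums of the singular series `𝔊_a`. -/
def singularPartial (a : Fin 4 → ℤ) (T : ℕ) : ℂ :=
  ∑ q ∈ Finset.Icc 1 T, (1 / (q : ℂ) ^ 4) * Sqa a 0 q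

/-- The quadratic form `G(x) = Σ εᵢ xᵢ²`. -/
def Gquad (e : Fin 4 → ℤ) (x : Fin 4 → ℝ) : ℝ := ∑ i, (e i : ℝ) * x i ^ 2

/-- The singular integral `σ_∞(ε)`. -/
def sigmaInf (e : Fin 4 → ℤ) : ℂ :=
  ∫ θ : ℝ, ∫ x in Set.univ.pi fun _ : Fin 4 => Set.Icc (-1 : ℝ) 1, eC (-(θ * Gquad e x))

/-- The weighted singular integral `σ_∞(w)`. -/
def sigmaInfW (w : (Fin 4 → ℝ) → ℝ) (e : Fin 4 → ℤ) : ℂ :=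
  ∫ θ : ℝ, ∫ x : Fin 4 → ℝ, (w x : ℂ) * eC (-(θ * Gquad e x))

/-- `Pᵢ = (B / |aᵢ|)^{1/2}`. -/
def Pvec (a : Fin 4 → ℤ) (B : ℝ) (i : Fin 4) : ℝ := Real.sqrt (B / ((a i).natAbs : ℝ))

/-- The oscillatory integral `I_{q,a}(c)`. -/
def Iqa (w : (Fin 4 → ℝ) → ℝ) (a : Fin 4 → ℤ) (B : ℝ) (c : Fin 4 → ℤ) (q : ℝ) : ℂ :=
  ∫ x : Fin 4 → ℝ,
    (w (fun i => x i / Pvec a B i) : ℂ) *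
      (hFn (q / Real.sqrt B) ((∑ i, (a i : ℝ) * x i ^ 2) / B) : ℂ) *
      eC (-(∑ i, (c i : ℝ) * x i) / q)

/-- `Δ(v) = ∏ᵢ gcd(vᵢ, ∏_{j≠i} vⱼ)`. -/
def Delta4 (v : Fin 4 → ℤ) : ℕ :=
  ∏ i, Int.gcd (v i) (∏ j ∈ Finset.univ.erase i, v j)

/-- `Δ_c(a) = ∏ᵢ gcd(gcd(aᵢ,cᵢ), ∏_{j≠i} gcd(aⱼ,cⱼ))`. -/
def DeltaC (a c : Fin 4 → ℤ) : ℕ :=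
  ∏ i, Int.gcd (Int.gcd (a i) (c i) : ℤ) (∏ j ∈ Finset.univ.erase i, (Int.gcd (a j) (c j) : ℤ))

/-- The dual form `F*_a(c)`. -/
def dualForm (a c : Fin 4 → ℤ) : ℤ :=
  ∑ i, (∏ j ∈ Finset.univ.erase i, a j) * c i ^ 2

/-- The counting function `N_a(B)`. -/
def Na (a : Fin 4 → ℤ) (B : ℝ) : ℕ :=
  {x : Fin 4 → ℤ | (∀ i, x i ≠ 0) ∧ (∑ i, a i * x i ^ 2) = 0 ∧
    ∀ i, (((a i * x i ^ 2).natAbs : ℝ)) ≤ B}.ncard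

/-- The smoothly weighted counting function `N_{w,a}(B)`. -/
def Nwa (w : (Fin 4 → ℝ) → ℝ) (a : Fin 4 → ℤ) (B : ℝ) : ℝ :=
  ∑' x : Fin 4 → ℤ,
    if (∀ i, x i ≠ 0) ∧ (∑ i, a i * x i ^ 2) = 0 then
      w fun i => (x i : ℝ) / Pvec a B i
    else 0

/-- The inclusion-exclusion weights `ω(r, s, s₀)`. -/
def omegaFn (r s : Fin 4 → ℕ) (s0 : ℕ) : ℤ :=
  if (∀ i, Squarefree (r i)) ∧ (∀ i, Squarefree (s i)) ∧
      Finset.univ.gcd s = 1 ∧ (∀ i, Nat.gcd s0 (s i) = 1) ∧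
      ∀ p : ℕ, p.Prime → p ∣ (∏ i, r i) * ∏ i, s i → ∀ i, p ∣ r i * s i then
    ArithmeticFunction.moebius s0 *
      ∏ p ∈ ((∏ i, r i) * ∏ i, s i).primeFactors,
        (-1 : ℤ) ^ (((∏ i, r i) * ∏ i, s i).factorization p + 1)
  else 0

/-- The cardinality of the set `𝒩(B; r, s, s₀)`. -/
def calN (B D : ℝ) (r s : Fin 4 → ℕ) (s0 : ℕ) : ℕ :=
  {z : Fin 4 → ℤ | (∀ i, z i ≠ 0) ∧ (∀ i, Squareful (z i)) ∧
    (∀ i, (((z i).natAbs : ℝ)) ≤ B) ∧ (∑ i, z i) = 0 ∧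
    ∃ x y : Fin 4 → ℤ,
      (∀ i, 0 < x i ∧ Squarefree (y i) ∧ z i = x i ^ 2 * y i ^ 3 ∧
        (r i : ℤ) ∣ y i ∧ (s i : ℤ) ∣ x i ∧ (s0 : ℤ) ∣ x i) ∧
      (((∏ i, y i).natAbs : ℝ)) ≤ D ∧ ¬ IsSquare (∏ i, y i)}.ncard

/-- The local counting function `M_n(y, p)`. -/
def Mcount (y : Fin 4 → ℤ) (p n : ℕ) : ℕ :=
  {m : Fin 4 → ℕ | (∀ i, m i < p ^ n) ∧ ((p : ℤ) ^ n ∣ ∑ i, y i ^ 3 * (m i : ℤ) ^ 2) ∧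
    ∃ j, ¬ (p : ℤ) ∣ (m j : ℤ) * y j}.ncard

end

/-- The absolute value of a term of the sum `E₁(D)`, indexed by `(r, s, s₀, y)`. -/
noncomputable def E1abs (D : ℝ) (Gv : (Fin 4 → ℕ) → (Fin 4 → ℤ) → ℂ) :
    (Fin 4 → ℕ) × (Fin 4 → ℕ) × ℕ × (Fin 4 → ℤ) → ℝ := fun t =>
  if (∀ i, Squarefree (t.2.2.2 i)) ∧ (∀ i, (t.1 i : ℤ) ∣ t.2.2.2 i) ∧
      ¬ IsSquare (∏ i, t.2.2.2 i) ∧ D < (((∏ i, t.2.2.2 i).natAbs : ℝ)) then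
    ((omegaFn t.1 t.2.1 t.2.2.1).natAbs : ℝ) * ‖Gv t.2.1 t.2.2.2‖ *
        ‖sigmaInf fun i => Int.sign (t.2.2.2 i)‖ /
      (((∏ i, t.2.1 i : ℕ) : ℝ) * (((∏ i, t.2.2.2 i).natAbs : ℝ)) ^ ((3 : ℝ) / 2) *
        (t.2.2.1 : ℝ) ^ 2)
  else 0

/-- A term of the sum `E₁(D)`, indexed by `(r, s, s₀, y)`. -/
noncomputable def E1term (D : ℝ) (Gv : (Fin 4 → ℕ) → (Fin 4 → ℤ) → ℂ) :
    (Fin 4 → ℕ) × (Fin 4 → ℕ) × ℕ × (Fin 4 → ℤ) → ℂ := fun t =>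
  if (∀ i, Squarefree (t.2.2.2 i)) ∧ (∀ i, (t.1 i : ℤ) ∣ t.2.2.2 i) ∧
      ¬ IsSquare (∏ i, t.2.2.2 i) ∧ D < (((∏ i, t.2.2.2 i).natAbs : ℝ)) then
    (omegaFn t.1 t.2.1 t.2.2.1 : ℂ) * Gv t.2.1 t.2.2.2 *
        sigmaInf (fun i => Int.sign (t.2.2.2 i)) /
      Complex.ofReal (((∏ i, t.2.1 i : ℕ) : ℝ) *
        (((∏ i, t.2.2.2 i).natAbs : ℝ)) ^ ((3 : ℝ) / 2) * (t.2.2.1 : ℝ) ^ 2)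
  else 0

open scoped NumberTheorySymbols

/-- Quadratic Gauss sum. -/
noncomputable def gS (q : ℕ) [NeZero q] (c : ZMod q) : ℂ :=
  ∑ x : ZMod q, ZMod.stdAddChar (c * x ^ 2)

lemma eC_int_div (q : ℕ) [NeZero q] (j : ℤ) :
    eC ((j : ℝ) / (q : ℝ)) = ZMod.stdAddChar (j : ZMod q) := by
  rw [ZMod.stdAddChar_coe, eC]
  congr 1
  push_cast
  ring

lemma sum_range_zmod (q : ℕ) [NeZero q] {M : Type*} [AddCommMonoid M] (f : ZMod q → M) :
    ∑ b ∈ Finset.range q, f (b : ZMod q) = ∑ x : ZMod q, f x := by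
  refine Finset.sum_bij' (fun b _ => (b : ZMod q)) (fun x _ => x.val) ?_ ?_ ?_ ?_ ?_
  · intros; simp
  · intro x _; simpa using ZMod.val_lt x
  · intro b hb; simpa using Nat.mod_eq_of_lt (by simpa using hb)
  · intro x _; simp
  · intros; rfl

lemma Sqa_eq (a : Fin 4 → ℤ) (q : ℕ) [NeZero q] :
    Sqa a 0 q = ∑ k : (ZMod q)ˣ, ∏ i, gS q ((k : ZMod q) * (a i : ZMod q)) := by
  have h1 : ∀ k : ℕ, ∑ b ∈ Fintype.piFinset fun _ : Fin 4 => Finset.range q,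
      eC (((((k : ℤ) * (∑ i, a i * (b i : ℤ) ^ 2) + ∑ i, (b i : ℤ) * (0 : Fin 4 → ℤ) i) : ℤ) : ℝ) / (q : ℝ))
      = ∏ i, gS q (((k : ZMod q)) * (a i : ZMod q)) := by
    intro k
    have : ∀ i, gS q ((k : ZMod q) * (a i : ZMod q)) =
        ∑ b ∈ Finset.range q, ZMod.stdAddChar ((k : ZMod q) * (a i : ZMod q) * (b : ZMod q) ^ 2) := by
      intro i
      rw [gS, sum_range_zmod q (fun x => ZMod.stdAddChar ((k : ZMod q) * (a i : ZMod q) * x ^ 2))]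
    simp_rw [this]
    rw [Finset.prod_univ_sum]
    refine Finset.sum_congr rfl fun b _ => ?_
    rw [eC_int_div]
    simp only [Fin.prod_univ_four, Fin.sum_univ_four, ← AddChar.map_add_eq_mul]
    congr 1
    push_cast
    simp
    ring
  rw [Sqa]
  simp_rw [h1]
  rw [Finset.sum_filter]
  have h2 : ∀ k : ℕ, (Nat.gcd k q = 1) ↔ IsUnit (k : ZMod q) := by
    intro k; rw [ZMod.isUnit_iff_coprime]
  simp_rw [h2]
  rw [sum_range_zmod q (fun x => if IsUnit x then ∏ i, gS q (x * (a i : ZMod q)) else 0),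
    ← Finset.sum_filter]
  symm
  refine Finset.sum_bij (fun k _ => (k : ZMod q)) ?_ ?_ ?_ ?_
  · intro k _; simp
  · intro k _ l _ h; exact Units.ext h
  · intro x hx
    exact ⟨(by simpa using hx : IsUnit x).unit, by simp, by simp⟩
  · intros; rfl

lemma gS_unit_sq (q : ℕ) [NeZero q] (c : ZMod q) (u : (ZMod q)ˣ) :
    gS q (c * (u : ZMod q) ^ 2) = gS q c := by
  rw [gS, gS]
  refine Fintype.sum_equiv (Units.mulLeft u) _ _ fun x => ?_
  simp; ring_nf

/-- number of zeros of linear map -/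
lemma card_zmod_mul_eq_zero (q : ℕ) [NeZero q] (a : ℤ) :
    (Finset.univ.filter fun h : ZMod q => (a : ZMod q) * h = 0).card ≤ Int.gcd a q := by
  set g := Int.gcd a q with hg
  have hq : 0 < q := NeZero.pos q
  have hgq : g ∣ q := by
    have := Int.gcd_dvd_right a q
    exact_mod_cast this
  have hg0 : 0 < g := Nat.pos_of_dvd_of_pos hgq hq
  obtain ⟨m, hm⟩ := hgq
  have hm0 : 0 < m := by
    rcases Nat.eq_zero_or_pos m with h | h
    · subst h; omega
    · exact h
  calc _ ≤ (Finset.range g).card := ?_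
    _ = g := by simp
  refine Finset.card_le_card_of_injOn (fun h => h.val / m) ?_ ?_
  · intro h _
    simp only [Finset.coe_range, Set.mem_Iio]
    rw [Nat.div_lt_iff_lt_mul hm0, ← hm]
    exact ZMod.val_lt h
  · have key : ∀ h : ZMod q, (a : ZMod q) * h = 0 → m ∣ h.val := by
      intro h hh
      have h1 : (q : ℤ) ∣ a * h.val := by
        rw [← ZMod.intCast_zmod_eq_zero_iff_dvd]
        push_cast
        simpa using hh
      obtain ⟨a', ha'⟩ : (g : ℤ) ∣ a := Int.gcd_dvd_left a q
      have hcop : IsCoprime (m : ℤ) a' := by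
        have := Int.isCoprime_iff_gcd_eq_one.2 (Int.gcd_ediv_gcd_ediv_gcd (i := a) (j := q) hg0)
        have e1 : a / (Int.gcd a q : ℤ) = a' := by
          rw [← hg, ha']; exact Int.mul_ediv_cancel_left _ (by exact_mod_cast hg0.ne')
        have e2 : (q : ℤ) / (Int.gcd a q : ℤ) = m := by
          rw [← hg, hm]; push_cast; exact Int.mul_ediv_cancel_left _ (by exact_mod_cast hg0.ne')
        rw [e1, e2] at this
        exact this.symm
      have h2 : (m : ℤ) ∣ a' * h.val := by
        have e3 : (q : ℤ) = g * m := by exact_mod_cast hm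
        rw [ha', e3, mul_assoc] at h1
        exact (mul_dvd_mul_iff_left (by exact_mod_cast hg0.ne')).1 h1
      exact_mod_cast hcop.dvd_of_dvd_mul_left h2
    intro h hh l hl e
    simp only [Finset.coe_filter, Finset.mem_univ, true_and, Set.mem_ofPred_eq] at hh hl e
    have a1 := Nat.div_mul_cancel (key h hh)
    have a2 := Nat.div_mul_cancel (key l hl)
    rw [e, a2] at a1
    exact ZMod.val_injective q a1.symm

lemma star_std (q : ℕ) [NeZero q] (x : ZMod q) :
    (starRingEnd ℂ) (ZMod.stdAddChar x) = ZMod.stdAddChar (-x) := by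
  rw [AddChar.map_neg_eq_conj]

lemma gS_mul_conj (q : ℕ) [NeZero q] (c : ZMod q) :
    gS q c * (starRingEnd ℂ) (gS q c) =
      q * ∑ h ∈ Finset.univ.filter (fun h : ZMod q => 2 * c * h = 0), ZMod.stdAddChar (c * h ^ 2) := by
  have h1 : gS q c * (starRingEnd ℂ) (gS q c) =
      ∑ x : ZMod q, ∑ h : ZMod q, ZMod.stdAddChar (c * h ^ 2) * ZMod.stdAddChar (x * (2 * c * h)) := by
    rw [gS, map_sum, Finset.sum_mul_sum, Finset.sum_comm]
    refine Finset.sum_congr rfl fun x _ => ?_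
    refine Fintype.sum_equiv (Equiv.subRight x) _ _ fun y => ?_
    rw [star_std, ← AddChar.map_add_eq_mul, ← AddChar.map_add_eq_mul]
    congr 1
    simp only [Equiv.subRight_apply]
    ring
  rw [h1, Finset.sum_comm, Finset.mul_sum, Finset.sum_filter]
  refine Finset.sum_congr rfl fun h _ => ?_
  rw [← Finset.mul_sum]
  have := AddChar.sum_mulShift (2 * c * h) (ZMod.isPrimitive_stdAddChar q)
  rw [this, ZMod.card]
  split_ifs
  · push_cast; ring
  · push_cast; ring

lemma norm_gS_sq_le (q : ℕ) [NeZero q] (k : (ZMod q)ˣ) (a : ℤ) :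
    ‖gS q ((k : ZMod q) * a)‖ ^ 2 ≤ 2 * q * (Int.gcd a q : ℝ) := by
  have h := gS_mul_conj q ((k : ZMod q) * a)
  rw [Complex.mul_conj, Complex.normSq_eq_norm_sq] at h
  have h2 := congrArg norm h
  rw [Complex.norm_real, Real.norm_of_nonneg (by positivity), norm_mul, Complex.norm_natCast] at h2
  rw [h2]
  have h3 : (Finset.univ.filter (fun h : ZMod q => 2 * ((k : ZMod q) * a) * h = 0)).card
      ≤ Int.gcd (2 * a) q := by
    refine le_trans (Finset.card_le_card ?_) (card_zmod_mul_eq_zero q (2 * a))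
    intro x hx
    simp only [Finset.mem_filter, Finset.mem_univ, true_and] at hx ⊢
    push_cast
    have : (k : ZMod q) * (2 * a * x) = 0 := by rw [← hx]; ring
    simpa using this
  have h4 : Int.gcd (2 * a) q ≤ 2 * Int.gcd a q := by
    have : Int.gcd (2 * a) q ∣ 2 * Int.gcd a q := by
      have := Int.gcd_mul_left 2 a q
      have h5 : Int.gcd (2 * a) q ∣ Int.gcd (2 * a) (2 * q) := Int.gcd_dvd_gcd_of_dvd_right _ (by simp)
      rw [this] at h5
      simpa using h5
    refine Nat.le_of_dvd ?_ this
    have : 0 < Int.gcd a q := Int.gcd_pos_of_ne_zero_right _ (by exact_mod_cast NeZero.ne q)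
    omega
  have h5 : ‖∑ h ∈ Finset.univ.filter (fun h : ZMod q => 2 * ((k : ZMod q) * a) * h = 0),
      ZMod.stdAddChar ((k : ZMod q) * (a : ZMod q) * h ^ 2)‖ ≤ ((2 * Int.gcd a q : ℕ) : ℝ) := by
    refine le_trans (norm_sum_le _ _) ?_
    simp only [ZMod.stdAddChar_apply, Circle.norm_coe, Finset.sum_const, nsmul_eq_mul, mul_one]
    exact_mod_cast h3.trans h4
  push_cast at h5
  calc _ ≤ (q : ℝ) * (2 * (Int.gcd a q : ℝ)) := by gcongr
    _ = _ := by ring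

lemma norm_Sqa_le (a : Fin 4 → ℤ) (q : ℕ) [NeZero q] :
    ‖Sqa a 0 q‖ ≤ 4 * (q : ℝ) ^ 3 * ∏ i, Real.sqrt (Int.gcd (a i) q) := by
  rw [Sqa_eq]
  have hb : ∀ k : (ZMod q)ˣ, ‖∏ i, gS q ((k : ZMod q) * (a i : ZMod q))‖ ≤
      4 * (q : ℝ) ^ 2 * ∏ i, Real.sqrt (Int.gcd (a i) q) := by
    intro k
    rw [norm_prod]
    calc _ ≤ ∏ i, (Real.sqrt (2 * q) * Real.sqrt (Int.gcd (a i) q)) := by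
          refine Finset.prod_le_prod (fun i _ => norm_nonneg _) fun i _ => ?_
          rw [← Real.sqrt_mul (by positivity)]
          exact Real.le_sqrt_of_sq_le (norm_gS_sq_le q k (a i))
      _ = _ := by
          rw [Finset.prod_mul_distrib]
          congr 1
          simp only [Finset.prod_const, Finset.card_univ, Fintype.card_fin]
          have := Real.sq_sqrt (show (0:ℝ) ≤ 2 * q by positivity)
          calc Real.sqrt (2 * q) ^ 4 = (Real.sqrt (2 * q) ^ 2) ^ 2 := by ring
            _ = _ := by rw [this]; ring
  refine le_trans (norm_sum_le _ _) (le_trans (Finset.sum_le_sum fun k _ => hb k) ?_)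
  rw [Finset.sum_const, nsmul_eq_mul, Finset.card_univ, ZMod.card_units_eq_totient]
  have : (Nat.totient q : ℝ) ≤ q := by exact_mod_cast Nat.totient_le q
  have h0 : 0 ≤ ∏ i, Real.sqrt (Int.gcd (a i) q) := Finset.prod_nonneg fun i _ => Real.sqrt_nonneg _
  calc _ ≤ (q : ℝ) * (4 * (q : ℝ) ^ 2 * ∏ i, Real.sqrt (Int.gcd (a i) q)) := by gcongr
    _ = _ := by ring

lemma std_mul_reduce (m n : ℕ) [NeZero m] [NeZero n] (j : ℤ) :
    (ZMod.stdAddChar (((m : ℤ) * j : ℤ) : ZMod (m * n)) : ℂ) = ZMod.stdAddChar (j : ZMod n) := by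
  rw [ZMod.stdAddChar_coe, ZMod.stdAddChar_coe]
  congr 1
  have h1 : (m : ℂ) ≠ 0 := by exact_mod_cast NeZero.ne m
  have h2 : (n : ℂ) ≠ 0 := by exact_mod_cast NeZero.ne n
  push_cast
  field_simp

lemma crt_char (m n : ℕ) [NeZero m] [NeZero n] (h : m.Coprime n) :
    ∃ (u : (ZMod m)ˣ) (v : (ZMod n)ˣ), ∀ x : ZMod (m * n),
      (ZMod.stdAddChar x : ℂ) = ZMod.stdAddChar ((u : ZMod m) * (ZMod.chineseRemainder h x).1) *
        ZMod.stdAddChar ((v : ZMod n) * (ZMod.chineseRemainder h x).2) := by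
  obtain ⟨V, U, hUV⟩ := Nat.isCoprime_iff_coprime.2 h
  have hu : (U : ZMod m) * (n : ZMod m) = 1 := by
    have := congrArg (Int.cast : ℤ → ZMod m) hUV
    push_cast at this
    simpa using this
  have hv : (V : ZMod n) * (m : ZMod n) = 1 := by
    have := congrArg (Int.cast : ℤ → ZMod n) hUV
    push_cast at this
    simpa using this
  refine ⟨⟨U, n, hu, by rw [mul_comm]; exact hu⟩, ⟨V, m, hv, by rw [mul_comm]; exact hv⟩, ?_⟩
  intro x
  obtain ⟨j, rfl⟩ := ZMod.intCast_surjective x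
  rw [map_intCast (ZMod.chineseRemainder h)]
  simp only [Prod.fst_intCast, Prod.snd_intCast]
  rw [← Int.cast_mul, ← Int.cast_mul, ZMod.stdAddChar_coe, ZMod.stdAddChar_coe, ZMod.stdAddChar_coe,
    ← Complex.exp_add]
  congr 1
  have h1 : (m : ℂ) ≠ 0 := by exact_mod_cast NeZero.ne m
  have h2 : (n : ℂ) ≠ 0 := by exact_mod_cast NeZero.ne n
  have h3 : (V : ℂ) * m + U * n = 1 := by exact_mod_cast hUV
  push_cast
  field_simp
  linear_combination (-(j : ℂ)) * h3

lemma crt_gS (m n : ℕ) [NeZero m] [NeZero n] (h : m.Coprime n) :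
    ∃ (u : (ZMod m)ˣ) (v : (ZMod n)ˣ), ∀ c : ZMod (m * n),
      gS (m * n) c = gS m ((u : ZMod m) * (ZMod.chineseRemainder h c).1) *
        gS n ((v : ZMod n) * (ZMod.chineseRemainder h c).2) := by
  obtain ⟨u, v, huv⟩ := crt_char m n h
  refine ⟨u, v, fun c => ?_⟩
  simp only [gS]
  rw [Finset.sum_mul_sum, ← Fintype.sum_prod_type']
  refine Fintype.sum_equiv (ZMod.chineseRemainder h).toEquiv _ _ fun x => ?_
  rw [huv]
  simp [mul_assoc]

lemma unit_int (q : ℕ) [NeZero q] (u : (ZMod q)ˣ) :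
    ∃ U : ℤ, (U : ZMod q) = u ∧ Int.gcd U q = 1 := by
  refine ⟨(u : ZMod q).val, by simp, ?_⟩
  have := ZMod.val_coe_unit_coprime u
  rw [Int.gcd_natCast_natCast]
  exact this

lemma crt_gS_int (m n : ℕ) [NeZero m] [NeZero n] (h : m.Coprime n) :
    ∃ U V : ℤ, Int.gcd U m = 1 ∧ Int.gcd V n = 1 ∧ ∀ c : ℤ,
      gS (m * n) c = gS m ((U * c : ℤ) : ZMod m) * gS n ((V * c : ℤ) : ZMod n) := by
  obtain ⟨u, v, huv⟩ := crt_gS m n h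
  obtain ⟨U, hU, hU'⟩ := unit_int m u
  obtain ⟨V, hV, hV'⟩ := unit_int n v
  refine ⟨U, V, hU', hV', fun c => ?_⟩
  rw [huv, map_intCast (ZMod.chineseRemainder h)]
  push_cast
  rw [hU, hV]
  simp

lemma sum_range_periodic {M : Type*} [AddCommMonoid M] (q : ℕ) (f : ℕ → M)
    (hf : ∀ x, f (q + x) = f x) (k : ℕ) :
    ∑ x ∈ Finset.range (k * q), f x = k • ∑ x ∈ Finset.range q, f x := by
  induction k with
  | zero => simp
  | succ k ih =>
    have : (k + 1) * q = q + k * q := by ring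
    rw [this, Finset.sum_range_add, add_comm]
    simp_rw [hf]
    rw [ih, succ_nsmul]

lemma gS_psq (p q' : ℕ) [hp : Fact p.Prime] [NeZero q'] (hp2 : p ≠ 2) (c : ℤ)
    (hc : ¬ (p : ℤ) ∣ c) :
    gS (p * (p * q')) c = p * gS q' c := by
  have hp0 : NeZero p := ⟨hp.out.ne_zero⟩
  set ψ : AddChar (ZMod (p * (p * q'))) ℂ := ZMod.stdAddChar with hψ
  -- averaging
  have h1 : ∀ x : ℤ, ∑ t ∈ Finset.range p, ψ (((c * (x + (p * q' : ℕ) * t) ^ 2 : ℤ)) : ZMod (p * (p * q')))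
      = if (p : ℤ) ∣ x then (p : ℂ) * ψ ((c * x ^ 2 : ℤ) : ZMod (p * (p * q'))) else 0 := by
    intro x
    have e1 : ∀ t : ℕ, ψ (((c * (x + (p * q' : ℕ) * t) ^ 2 : ℤ)) : ZMod (p * (p * q')))
        = ψ ((c * x ^ 2 : ℤ) : ZMod (p * (p * q'))) *
          ZMod.stdAddChar ((t : ZMod p) * ((2 * c * x : ℤ) : ZMod p)) := by
      intro t
      have e2 : ((c * (x + (p * q' : ℕ) * t) ^ 2 : ℤ) : ZMod (p * (p * q'))) =
          ((c * x ^ 2 : ℤ) : ZMod (p * (p * q'))) +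
          (((p * q' : ℕ) : ℤ) * (t * (2 * c * x)) : ℤ) := by
        have e3 : ((p * (p * q') : ℕ) : ZMod (p * (p * q'))) = 0 := ZMod.natCast_self _
        push_cast at e3 ⊢
        linear_combination (c : ZMod (p * (p * q'))) * q' * t ^ 2 * e3
      rw [e2, AddChar.map_add_eq_mul]
      congr 1
      have e4 : ∀ (N : ℕ) [NeZero N], N = (p * q') * p → ∀ j : ℤ,
          (ZMod.stdAddChar ((((p * q' : ℕ) : ℤ) * j : ℤ) : ZMod N) : ℂ) =
          ZMod.stdAddChar (j : ZMod p) := by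
        intro N _ hN j
        subst hN
        exact std_mul_reduce (p * q') p j
      rw [hψ, e4 _ (by ring)]
      push_cast
      rfl
    simp_rw [e1]
    rw [← Finset.mul_sum, sum_range_zmod p (fun t => (ZMod.stdAddChar (t * ((2 * c * x : ℤ) : ZMod p)) : ℂ)),
      AddChar.sum_mulShift _ (ZMod.isPrimitive_stdAddChar p), ZMod.card]
    have e5 : ((2 * c * x : ℤ) : ZMod p) = 0 ↔ (p : ℤ) ∣ x := by
      rw [ZMod.intCast_zmod_eq_zero_iff_dvd]
      have hpp : Prime (p : ℤ) := Nat.prime_iff_prime_int.1 hp.out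
      constructor
      · intro h
        rcases hpp.dvd_or_dvd h with h | h
        · rcases hpp.dvd_or_dvd h with h | h
          · exfalso
            have : p ∣ 2 := by exact_mod_cast h
            exact hp2 ((Nat.prime_dvd_prime_iff_eq hp.out Nat.prime_two).1 this)
          · exact absurd h hc
        · exact h
      · intro h; exact Dvd.dvd.mul_left h _
    by_cases hx : (p : ℤ) ∣ x
    · rw [if_pos (e5.2 hx), if_pos hx]; push_cast; ring
    · rw [if_neg (fun h => hx (e5.1 h)), if_neg hx]; simp
  have h2 : (p : ℂ) * gS (p * (p * q')) c =
      ∑ t ∈ Finset.range p, ∑ x ∈ Finset.range (p * (p * q')),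
        ψ (((c * ((x : ℤ) + (p * q' : ℕ) * t) ^ 2 : ℤ)) : ZMod (p * (p * q'))) := by
    have : ∀ t ∈ Finset.range p, ∑ x ∈ Finset.range (p * (p * q')),
        ψ (((c * ((x : ℤ) + (p * q' : ℕ) * t) ^ 2 : ℤ)) : ZMod (p * (p * q'))) =
        gS (p * (p * q')) c := by
      intro t _
      rw [gS]
      have := sum_range_zmod (p * (p * q')) (fun y => ψ ((c : ZMod (p * (p * q'))) *
        (y + ((p * q' : ℕ) : ZMod (p * (p * q'))) * t) ^ 2))
      push_cast at this ⊢
      rw [this]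
      refine Fintype.sum_equiv (Equiv.addRight (((p : ZMod (p * (p * q'))) * q') * t)) _ _ fun y => ?_
      simp
      rfl
    rw [Finset.sum_congr rfl this]
    simp
  rw [Finset.sum_comm] at h2
  simp_rw [h1] at h2
  rw [← Finset.sum_filter] at h2
  have h3 : ∑ x ∈ Finset.range (p * (p * q')) with ((p : ℤ) ∣ ((x : ℕ) : ℤ)),
      (p : ℂ) * ψ ((c * (x : ℤ) ^ 2 : ℤ) : ZMod (p * (p * q'))) =
      ∑ y ∈ Finset.range (p * q'), (p : ℂ) * ZMod.stdAddChar ((c * (y : ℤ) ^ 2 : ℤ) : ZMod q') := by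
    symm
    refine Finset.sum_bij (fun y _ => p * y) ?_ ?_ ?_ ?_
    · intro y hy
      simp only [Finset.mem_range, Finset.mem_filter] at hy ⊢
      refine ⟨(Nat.mul_lt_mul_left hp.out.pos).2 hy, by simp⟩
    · intro y _ z _ h
      exact Nat.eq_of_mul_eq_mul_left hp.out.pos h
    · intro x hx
      simp only [Finset.mem_range, Finset.mem_filter] at hx
      obtain ⟨hx1, hx2⟩ := hx
      obtain ⟨y, rfl⟩ : p ∣ x := by exact_mod_cast hx2
      exact ⟨y, by simpa using (Nat.mul_lt_mul_left hp.out.pos).1 hx1, rfl⟩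
    · intro y _
      congr 1
      rw [hψ, ← std_mul_reduce (p * p) q']
      have e4 : ∀ (N M : ℕ) [NeZero N] [NeZero M], N = M → ∀ j : ℤ,
          (ZMod.stdAddChar (j : ZMod N) : ℂ) = ZMod.stdAddChar (j : ZMod M) := by
        intro N M _ _ h j
        subst h
        congr
      rw [e4 (p * p * q') (p * (p * q')) (by ring)]
      congr 2
      push_cast
      ring
  rw [h3, ← Finset.mul_sum] at h2
  have hpc : (p : ℂ) ≠ 0 := by exact_mod_cast hp.out.ne_zero
  rw [mul_right_inj' hpc] at h2
  rw [h2, sum_range_periodic q' (fun y => ZMod.stdAddChar ((c * (y : ℤ) ^ 2 : ℤ) : ZMod q')), nsmul_eq_mul]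
  · congr 1
    rw [gS, ← sum_range_zmod]
    push_cast
    rfl
  · intro x
    push_cast
    simp

lemma gS_prime (p : ℕ) [hp : Fact p.Prime] (hp2 : p ≠ 2) (c : ℤ) (hc : Int.gcd c p = 1) :
    gS p c = (J(c | p) : ℂ) * gS p 1 := by
  have hcz : (c : ZMod p) ≠ 0 := by
    intro h
    rw [ZMod.intCast_zmod_eq_zero_iff_dvd] at h
    have h2 : p ∣ Int.gcd c p := by
      have := Int.dvd_coe_gcd h (dvd_refl (p : ℤ))
      exact_mod_cast this
    rw [hc] at h2
    exact hp.out.one_lt.ne' (Nat.dvd_one.1 h2)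
  have hch : ringChar (ZMod p) ≠ 2 := by rwa [ZMod.ringChar_zmod_n]
  have key : ∀ d : ZMod p, d ≠ 0 → gS p d = ∑ y : ZMod p, (quadraticChar (ZMod p) y : ℂ) * ZMod.stdAddChar (d * y) := by
    intro d hd
    have h1 : gS p d = ∑ y : ZMod p, ((quadraticChar (ZMod p) y + 1 : ℤ) : ℂ) * ZMod.stdAddChar (d * y) := by
      rw [gS, ← Finset.sum_fiberwise (s := Finset.univ) (g := fun x : ZMod p => x ^ 2)]
      refine Finset.sum_congr rfl fun y _ => ?_
      rw [← quadraticChar_card_sqrts hch y]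
      have : ∀ x ∈ Finset.univ.filter (fun x : ZMod p => x ^ 2 = y), (ZMod.stdAddChar (d * x ^ 2) : ℂ) = ZMod.stdAddChar (d * y) := by
        intro x hx
        rw [(by simpa using hx : x ^ 2 = y)]
      rw [Finset.sum_congr rfl this, Finset.sum_const, nsmul_eq_mul]
      congr 2
      congr 1
      ext x
      simp
    rw [h1]
    have h2 : ∑ y : ZMod p, (ZMod.stdAddChar (d * y) : ℂ) = 0 := by
      have := AddChar.sum_mulShift d (ZMod.isPrimitive_stdAddChar p)
      rw [if_neg hd] at this
      simpa [mul_comm] using this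
    push_cast
    simp_rw [add_mul, one_mul]
    rw [Finset.sum_add_distrib, h2, add_zero]
  rw [key _ hcz, key 1 one_ne_zero, Finset.mul_sum]
  refine Fintype.sum_equiv (Equiv.mulLeft₀ (c : ZMod p) hcz) _ _ fun y => ?_
  have hJ : (J(c | p)) = quadraticChar (ZMod p) (c : ZMod p) := by
    rw [← jacobiSym.legendreSym.to_jacobiSym]; rfl
  have hE : Equiv.mulLeft₀ (c : ZMod p) hcz y = (c : ZMod p) * y := rfl
  rw [hE, one_mul, hJ, map_mul (quadraticChar (ZMod p))]
  have : (quadraticChar (ZMod p) (c : ZMod p) : ℂ) ^ 2 = 1 := by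
    exact_mod_cast quadraticChar_sq_one hcz
  push_cast
  linear_combination (-(quadraticChar (ZMod p) y : ℂ) * ZMod.stdAddChar ((c : ZMod p) * y)) * this

lemma gS_odd (q : ℕ) : ∀ [NeZero q], Odd q → ∀ c : ℤ, Int.gcd c q = 1 →
    gS q c = (J(c | q) : ℂ) * gS q 1 := by
  induction q using Nat.strong_induction_on with
  | _ q ih =>
  intro hq0 hodd c hc
  by_cases hq1 : q = 1
  · subst hq1
    rw [jacobiSym.one_right]
    rw [Subsingleton.elim (c : ZMod 1) 1]
    simp
  obtain ⟨p, hp, m, rfl⟩ : ∃ p, p.Prime ∧ p ∣ q := Nat.exists_prime_and_dvd hq1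
  have : Fact p.Prime := ⟨hp⟩
  have : NeZero p := ⟨hp.ne_zero⟩
  have hm0 : m ≠ 0 := by rintro rfl; exact hq0.out (Nat.mul_zero p)
  have hpo : Odd p := (Nat.odd_mul.1 hodd).1
  have hmo : Odd m := (Nat.odd_mul.1 hodd).2
  have hp2 : p ≠ 2 := by rintro rfl; exact absurd hpo (by decide)
  have hcp : Int.gcd c p = 1 := by
    refine Nat.dvd_one.1 (hc ▸ Int.gcd_dvd_gcd_of_dvd_right _ ?_); push_cast; exact Dvd.intro _ rfl
  have hcm : Int.gcd c m = 1 := by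
    refine Nat.dvd_one.1 (hc ▸ Int.gcd_dvd_gcd_of_dvd_right _ ?_); push_cast; exact Dvd.intro_left _ rfl
  have : NeZero m := ⟨hm0⟩
  have ndvd : ∀ d : ℤ, Int.gcd d p = 1 → ¬ (p : ℤ) ∣ d := by
    intro d hd h
    have h2 : p ∣ Int.gcd d p := by
      have := Int.dvd_coe_gcd h (dvd_refl (p : ℤ))
      exact_mod_cast this
    rw [hd] at h2
    exact hp.one_lt.ne' (Nat.dvd_one.1 h2)
  by_cases hpm : p ∣ m
  · obtain ⟨q', rfl⟩ := hpm
    have hq'0 : q' ≠ 0 := by rintro rfl; simp at hm0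
    have : NeZero q' := ⟨hq'0⟩
    have hcq : Int.gcd c q' = 1 := by
      refine Nat.dvd_one.1 (hcm ▸ Int.gcd_dvd_gcd_of_dvd_right _ ?_); push_cast; exact Dvd.intro_left _ rfl
    have hlt : q' < p * (p * q') := by
      have := hp.two_le
      have h0 : 0 < q' := Nat.pos_of_ne_zero hq'0
      have h1 : q' < p * q' := by nlinarith
      nlinarith
    have e1 := gS_psq p q' hp2 c (ndvd c hcp)
    have e2 := gS_psq p q' hp2 1 (ndvd 1 (by simp))
    have e3 := ih q' hlt (Nat.odd_mul.1 hmo).2 c hcq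
    simp only [Int.cast_one] at e2
    rw [e1, e2, e3, jacobiSym.mul_right, jacobiSym.mul_right]
    have : (J(c | p) : ℂ) ^ 2 = 1 := by exact_mod_cast jacobiSym.sq_one hcp
    push_cast
    linear_combination (-(p : ℂ) * (J(c | q') : ℂ) * gS q' 1) * this
  · have hcop : p.Coprime m := (Nat.Prime.coprime_iff_not_dvd hp).2 hpm
    obtain ⟨U, V, hU, hV, hUV⟩ := crt_gS_int p m hcop
    have hlt : m < p * m := by
      have := hp.two_le
      have : 0 < m := Nat.pos_of_ne_zero hm0
      nlinarith
    have g1 : ∀ d : ℤ, Int.gcd d p = 1 → Int.gcd (U * d) p = 1 := fun d hd => by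
      rw [← Int.isCoprime_iff_gcd_eq_one] at *; exact IsCoprime.mul_left hU hd
    have g2 : ∀ d : ℤ, Int.gcd d m = 1 → Int.gcd (V * d) m = 1 := fun d hd => by
      rw [← Int.isCoprime_iff_gcd_eq_one] at *; exact IsCoprime.mul_left hV hd
    have e1 := hUV c
    have e2 := hUV 1
    rw [gS_prime p hp2 _ (g1 c hcp), ih m hlt hmo _ (g2 c hcm)] at e1
    rw [gS_prime p hp2 _ (g1 1 (by simp)), ih m hlt hmo _ (g2 1 (by simp))] at e2
    rw [Int.cast_one] at e2
    rw [e1, e2]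
    simp only [jacobiSym.mul_left, jacobiSym.one_left, jacobiSym.mul_right]
    push_cast
    ring

lemma gS_one_pow_four (q : ℕ) [NeZero q] (hq : Odd q) : gS q 1 ^ 4 = (q : ℂ) ^ 2 := by
  have h := gS_mul_conj q 1
  have h2u : IsUnit (2 : ZMod q) := by
    have : IsUnit ((2 : ℕ) : ZMod q) := by
      rw [ZMod.isUnit_iff_coprime]
      exact (Nat.coprime_two_left).2 hq
    simpa using this
  have hf : (Finset.univ.filter (fun h : ZMod q => 2 * 1 * h = 0)) = {0} := by
    ext x
    simp [h2u.mul_right_eq_zero]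
  rw [hf] at h
  simp only [Finset.sum_singleton] at h
  have hconj : (starRingEnd ℂ) (gS q 1) = gS q ((-1 : ℤ) : ZMod q) := by
    rw [gS, gS, map_sum]
    refine Finset.sum_congr rfl fun x _ => ?_
    rw [star_std]
    simp
  have hg : Int.gcd (-1) q = 1 := by simp
  rw [hconj, gS_odd q hq (-1) hg] at h
  have hJ : (J(-1 | q) : ℂ) ^ 2 = 1 := by exact_mod_cast jacobiSym.sq_one hg
  have h0 : (1 : ZMod q) * 0 ^ 2 = 0 := by ring
  rw [h0, AddChar.map_zero_eq_one] at h
  have := congrArg (fun z => z ^ 2) h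
  linear_combination this - gS q 1 ^ 4 * hJ

lemma prod_gS (q : ℕ) [NeZero q] (hq : Odd q) (a : Fin 4 → ℤ) (ha : Int.gcd (∏ i, a i) q = 1)
    (k : (ZMod q)ˣ) :
    ∏ i, gS q ((k : ZMod q) * (a i : ZMod q)) = (q : ℂ) ^ 2 * (J(∏ i, a i | q) : ℂ) := by
  obtain ⟨K, hK, hK'⟩ := unit_int q k
  have hai : ∀ i, Int.gcd (K * a i) q = 1 := by
    intro i
    rw [← Int.isCoprime_iff_gcd_eq_one] at *
    exact IsCoprime.mul_left hK' (IsCoprime.of_isCoprime_of_dvd_left ha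
      (Finset.dvd_prod_of_mem a (Finset.mem_univ i)))
  have h1 : ∀ i, gS q ((k : ZMod q) * (a i : ZMod q)) = (J(K | q) : ℂ) * (J(a i | q) : ℂ) * gS q 1 := by
    intro i
    rw [← hK, ← Int.cast_mul, gS_odd q hq _ (hai i), jacobiSym.mul_left]
    push_cast; ring
  simp_rw [h1]
  have hJ : (J(K | q) : ℂ) ^ 2 = 1 := by exact_mod_cast jacobiSym.sq_one hK'
  have h4 := gS_one_pow_four q hq
  simp only [Fin.prod_univ_four, jacobiSym.mul_left]
  push_cast
  have hJ4 : (J(K | q) : ℂ) ^ 4 = 1 := by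
    linear_combination (1 + (J(K | q) : ℂ) ^ 2) * hJ
  calc _ = (J(K | q) : ℂ) ^ 4 * gS q 1 ^ 4 * ((J(a 0 | q) : ℂ) * (J(a 1 | q) : ℂ) * (J(a 2 | q) : ℂ) * (J(a 3 | q) : ℂ)) := by ring
    _ = _ := by rw [hJ4, h4]; ring

lemma Sqa_mul (a : Fin 4 → ℤ) (m n : ℕ) [NeZero m] [NeZero n] (h : m.Coprime n) (hn : Odd n)
    (ha : Int.gcd (∏ i, a i) n = 1) :
    Sqa a 0 (m * n) = Sqa a 0 m * ((Nat.totient n : ℂ) * (n : ℂ) ^ 2 * (J(∏ i, a i | n) : ℂ)) := by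
  rw [Sqa_eq, Sqa_eq]
  obtain ⟨u, v, huv⟩ := crt_gS m n h
  obtain ⟨E, hE1, hE2⟩ : ∃ E : (ZMod (m * n))ˣ ≃ (ZMod m)ˣ × (ZMod n)ˣ,
      (∀ k, ((E k).1 : ZMod m) = (ZMod.chineseRemainder h (k : ZMod (m * n))).1) ∧
      (∀ k, ((E k).2 : ZMod n) = (ZMod.chineseRemainder h (k : ZMod (m * n))).2) :=
    ⟨((Units.mapEquiv (ZMod.chineseRemainder h).toMulEquiv).trans MulEquiv.prodUnits).toEquiv,
      fun _ => rfl, fun _ => rfl⟩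
  have h1 : ∀ k : (ZMod (m * n))ˣ, ∏ i, gS (m * n) ((k : ZMod (m * n)) * (a i : ZMod (m * n))) =
      (∏ i, gS m ((u * (E k).1 : (ZMod m)ˣ) * (a i : ZMod m))) *
      ((n : ℂ) ^ 2 * (J(∏ i, a i | n) : ℂ)) := by
    intro k
    simp_rw [huv]
    rw [Finset.prod_mul_distrib]
    congr 1
    · refine Finset.prod_congr rfl fun i _ => ?_
      congr 1
      rw [map_mul (ZMod.chineseRemainder h), map_intCast (ZMod.chineseRemainder h)]
      simp [mul_assoc, hE1]
    · rw [← prod_gS n hn a ha (v * (E k).2)]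
      refine Finset.prod_congr rfl fun i _ => ?_
      congr 1
      rw [map_mul (ZMod.chineseRemainder h), map_intCast (ZMod.chineseRemainder h)]
      simp [mul_assoc, hE2]
  rw [Fintype.sum_congr _ _ h1]
  rw [← Finset.sum_mul]
  rw [Fintype.sum_equiv E _
    (fun x : (ZMod m)ˣ × (ZMod n)ˣ => ∏ i, gS m ((u * x.1 : (ZMod m)ˣ) * (a i : ZMod m))) (fun k => rfl)]
  rw [Fintype.sum_prod_type]
  simp only [Finset.sum_const, Finset.card_univ, ZMod.card_units_eq_totient, nsmul_eq_mul]
  rw [← Finset.mul_sum]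
  rw [Fintype.sum_equiv (Equiv.mulLeft u) (fun x : (ZMod m)ˣ => ∏ i, gS m ((u * x : (ZMod m)ˣ) * (a i : ZMod m)))
    (fun k => ∏ i, gS m ((k : ZMod m) * (a i : ZMod m))) (fun k => rfl)]
  ring

/-- The real character attached to `Y`. -/
noncomputable def chiY (Y : ℤ) (n : ℕ) : ℝ := if Odd n then (J(Y | n) : ℝ) else 0

lemma chiY_mul (Y : ℤ) (m n : ℕ) : chiY Y (m * n) = chiY Y m * chiY Y n := by
  unfold chiY
  by_cases hm : Odd m <;> by_cases hn : Odd n <;> simp [Nat.odd_mul, hm, hn]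
  have : NeZero m := ⟨by rintro rfl; simp at hm⟩
  have : NeZero n := ⟨by rintro rfl; simp at hn⟩
  rw [jacobiSym.mul_right]; push_cast; rfl

lemma abs_chiY_le (Y : ℤ) (n : ℕ) : |chiY Y n| ≤ 1 := by
  unfold chiY
  split_ifs
  · rcases jacobiSym.trichotomy Y n with h | h | h <;> rw [h] <;> simp
  · simp

lemma chiY_periodic (Y : ℤ) (n : ℕ) : chiY Y (4 * Y.natAbs + n) = chiY Y n := by
  unfold chiY
  have : Odd (4 * Y.natAbs + n) ↔ Odd n := by
    rw [Nat.odd_add]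
    have : Even (4 * Y.natAbs) := ⟨2 * Y.natAbs, by ring⟩
    have h2 : ¬ Odd (4 * Y.natAbs) := Nat.not_odd_iff_even.2 this
    rw [← Nat.not_odd_iff_even]
    tauto
  by_cases hn : Odd n
  · rw [if_pos hn, if_pos (this.2 hn), jacobiSym.mod_right _ hn, jacobiSym.mod_right _ (this.2 hn)]
    simp
  · rw [if_neg hn, if_neg (fun h => hn (this.1 h))]

lemma jacobi_one_of_mod (Z : ℤ) (hZ : Z ≠ 0) (n : ℕ) (hn : Odd n) (h : n ≡ 1 [MOD 4 * Z.natAbs]) :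
    J(Z | n) = 1 := by
  rw [jacobiSym.mod_right _ hn, h, Nat.mod_eq_of_lt, jacobiSym.one_right]
  have := Int.natAbs_pos.2 hZ
  omega

lemma exists_jacobi_neg_odd (p : ℕ) (hp : p.Prime) (hp2 : p ≠ 2) (k : ℕ) (Z : ℤ) (hZ : Z ≠ 0)
    (hpZ : ¬ (p : ℤ) ∣ Z) : ∃ n : ℕ, Odd n ∧ J((p : ℤ) ^ (2 * k + 1) * Z | n) = -1 := by
  have : Fact p.Prime := ⟨hp⟩
  have hpo : Odd p := hp.odd_of_ne_two hp2
  obtain ⟨r, hr⟩ := FiniteField.exists_nonsquare (F := ZMod p) (by rwa [ZMod.ringChar_zmod_n])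
  have hcop : Nat.Coprime (4 * Z.natAbs) p := by
    rw [Nat.coprime_comm, Nat.Prime.coprime_iff_not_dvd hp]
    intro h
    rcases hp.dvd_mul.1 h with h | h
    · have : p ∣ 2 ^ 2 := by simpa using h
      exact hp2 ((Nat.prime_dvd_prime_iff_eq hp Nat.prime_two).1 (hp.dvd_of_dvd_pow this))
    · exact hpZ (Int.natCast_dvd.2 h)
  obtain ⟨n, hn1, hn2⟩ := Nat.chineseRemainder hcop 1 r.val
  have hn4 : n ≡ 1 [MOD 4] := hn1.of_dvd (Dvd.intro _ rfl)
  have hn4' : n % 4 = 1 := hn4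
  have hno : Odd n := by rw [Nat.odd_iff]; omega
  refine ⟨n, hno, ?_⟩
  rw [jacobiSym.mul_left, jacobi_one_of_mod Z hZ n hno hn1, jacobiSym.pow_left,
    jacobiSym.quadratic_reciprocity_one_mod_four' hpo hn4']
  have : J((n : ℤ) | p) = -1 := by
    rw [ZMod.nonsquare_iff_jacobiSym_eq_neg_one]
    have : ((n : ℤ) : ZMod p) = r := by
      have := (ZMod.natCast_eq_natCast_iff _ _ _).2 hn2
      push_cast
      rw [this]; simp
    rwa [this]
  rw [this]
  simp [pow_succ, pow_mul]

lemma exists_jacobi_neg_two (t : ℤ) (r : ℕ) (ho : Odd r) (hr : ∀ n : ℕ, n % 8 = r % 8 → J(t | n) = -1) (b : ℕ)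
    (hb : b ≠ 0) : ∃ n : ℕ, Odd n ∧ J(t * (b : ℤ) ^ 2 | n) = -1 := by
  obtain ⟨k, c, hc, rfl⟩ := Nat.exists_eq_pow_mul_and_not_dvd hb 2 (by norm_num)
  have hco : Nat.Coprime 2 c := (Nat.Prime.coprime_iff_not_dvd Nat.prime_two).2 hc
  have hcop : Nat.Coprime 8 c := by
    have := Nat.Coprime.pow_left 3 hco
    simpa using this
  obtain ⟨n, hn1, hn2⟩ := Nat.chineseRemainder hcop r 1
  have h8 : n % 8 = r % 8 := hn1
  have hno : Odd n := by
    rw [Nat.odd_iff] at *; omega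
  refine ⟨n, hno, ?_⟩
  rw [jacobiSym.mul_left, hr n h8, jacobiSym.sq_one', mul_one]
  rw [Int.gcd_natCast_natCast]
  refine Nat.Coprime.mul_left (Nat.Coprime.pow_left _ (Nat.coprime_two_left.2 hno)) ?_
  have : Nat.gcd n c = Nat.gcd 1 c := hn2.gcd_eq
  rw [Nat.Coprime, Nat.gcd_comm, this]; simp

lemma exists_jacobi_neg (Y : ℤ) (hY : ¬ IsSquare Y) : ∃ n : ℕ, Odd n ∧ J(Y | n) = -1 := by
  have hY0 : Y ≠ 0 := by rintro rfl; exact hY (by simp)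
  obtain ⟨a, b, hab, ha⟩ := Nat.sq_mul_squarefree Y.natAbs
  have hb0 : b ≠ 0 := by
    rintro rfl; simp at hab; exact hY0 (Int.natAbs_eq_zero.1 (by omega))
  obtain ⟨σ, hσ, hYσ⟩ : ∃ σ : ℤ, (σ = 1 ∨ σ = -1) ∧ Y = σ * a * (b : ℤ) ^ 2 := by
    rcases Int.natAbs_eq Y with h | h
    · refine ⟨1, Or.inl rfl, ?_⟩; rw [h, ← hab]; push_cast; ring
    · refine ⟨-1, Or.inr rfl, ?_⟩; rw [h, ← hab]; push_cast; ring
  by_cases hp : ∃ p : ℕ, p.Prime ∧ p ≠ 2 ∧ p ∣ a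
  · obtain ⟨p, hp, hp2, a', rfl⟩ := hp
    obtain ⟨k, b', hb', rfl⟩ := Nat.exists_eq_pow_mul_and_not_dvd hb0 p hp.ne_one
    have hpa' : ¬ p ∣ a' := by
      rintro ⟨c, rfl⟩
      have := ha p ⟨c, by ring⟩
      exact hp.one_lt.ne' (Nat.isUnit_iff.1 this)
    have hpi : Prime (p : ℤ) := Nat.prime_iff_prime_int.1 hp
    have hZ : ¬ (p : ℤ) ∣ σ * a' * (b' : ℤ) ^ 2 := by
      intro h
      rcases hpi.dvd_or_dvd h with h | h
      · rcases hpi.dvd_or_dvd h with h | h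
        · exact hpi.not_dvd_one (by rcases hσ with rfl | rfl <;> simpa using h)
        · exact hpa' (by exact_mod_cast h)
      · exact hb' (by exact_mod_cast hpi.dvd_of_dvd_pow h)
    obtain ⟨n, hn, hJ⟩ := exists_jacobi_neg_odd p hp hp2 k (σ * a' * (b' : ℤ) ^ 2)
      (by intro h; rw [h] at hZ; simp at hZ) hZ
    refine ⟨n, hn, ?_⟩
    rw [← hJ, hYσ]
    congr 1
    push_cast
    ring
  · push Not at hp
    have ha12 : a = 1 ∨ a = 2 := by
      by_cases h2 : 2 ∣ a
      · obtain ⟨c, rfl⟩ := h2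
        right
        have hc : c = 1 := by
          by_contra hc
          obtain ⟨p, hpp, hpc⟩ := Nat.exists_prime_and_dvd hc
          by_cases h : p = 2
          · subst h
            obtain ⟨d, rfl⟩ := hpc
            have := ha 2 ⟨d, by ring⟩
            exact absurd (Nat.isUnit_iff.1 this) (by norm_num)
          · exact hp p hpp h (Dvd.dvd.mul_left hpc 2)
        rw [hc]
      · left
        by_contra hc
        obtain ⟨p, hpp, hpc⟩ := Nat.exists_prime_and_dvd hc
        by_cases h : p = 2
        · subst h; exact h2 hpc
        · exact hp p hpp h hpc
    have hodd : ∀ n r : ℕ, Odd r → n % 8 = r % 8 → Odd n := by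
      intro n r hr h; rw [Nat.odd_iff] at *; omega
    rcases ha12 with rfl | rfl <;> rcases hσ with rfl | rfl
    · exfalso; apply hY; rw [hYσ]; exact ⟨b, by push_cast; ring⟩
    · obtain ⟨n, hn, h⟩ := exists_jacobi_neg_two (-1) 3 (by decide) (by
        intro n hn
        rw [jacobiSym.at_neg_one (hodd n 3 (by decide) hn), ZMod.χ₄_nat_mod_four]
        have : n % 4 = 3 := by omega
        rw [this]; rfl) b hb0
      refine ⟨n, hn, ?_⟩
      rw [← h, hYσ]; congr 1
    · obtain ⟨n, hn, h⟩ := exists_jacobi_neg_two 2 5 (by decide) (by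
        intro n hn
        rw [jacobiSym.at_two (hodd n 5 (by decide) hn), ZMod.χ₈_nat_mod_eight]
        have : n % 8 = 5 := by omega
        rw [this]; rfl) b hb0
      refine ⟨n, hn, ?_⟩
      rw [← h, hYσ]; congr 1
    · obtain ⟨n, hn, h⟩ := exists_jacobi_neg_two (-2) 5 (by decide) (by
        intro n hn
        have hno := hodd n 5 (by decide) hn
        rw [show (-2 : ℤ) = (-1) * 2 by norm_num, jacobiSym.mul_left, jacobiSym.at_neg_one hno,
          jacobiSym.at_two hno, ZMod.χ₄_nat_mod_four, ZMod.χ₈_nat_mod_eight]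
        have h1 : n % 8 = 5 := by omega
        have h2 : n % 4 = 1 := by omega
        rw [h1, h2]; rfl) b hb0
      refine ⟨n, hn, ?_⟩
      rw [← h, hYσ]; congr 1

lemma chiY_mod (Y : ℤ) (n : ℕ) : chiY Y (n % (4 * Y.natAbs)) = chiY Y n := by
  have hp : Function.Periodic (chiY Y) (4 * Y.natAbs) := fun x => by rw [add_comm]; exact chiY_periodic Y x
  exact hp.map_mod_nat n

lemma chiY_sum_period (Y : ℤ) (hY : ¬ IsSquare Y) :
    ∑ j ∈ Finset.range (4 * Y.natAbs), chiY Y j = 0 := by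
  have hY0 : Y ≠ 0 := by rintro rfl; exact hY (by simp)
  obtain ⟨n, hn, hJ⟩ := exists_jacobi_neg Y hY
  have hchi : chiY Y n = -1 := by rw [chiY, if_pos hn, hJ]; simp
  have hpos := Int.natAbs_pos.2 hY0
  have : NeZero (4 * Y.natAbs) := ⟨by omega⟩
  have hcop : Nat.Coprime n (4 * Y.natAbs) := by
    refine Nat.Coprime.mul_right ?_ ?_
    · have := Nat.Coprime.pow_right 2 (Nat.coprime_two_right.2 hn); simpa using this
    · by_contra h
      have : NeZero n := ⟨by rintro rfl; simp at hn⟩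
      have h2 : Int.gcd Y n ≠ 1 := by
        intro h3; apply h
        rw [Nat.Coprime, Nat.gcd_comm]; simpa [Int.gcd] using h3
      have := (jacobiSym.eq_zero_iff_not_coprime (a := Y) (b := n)).2 h2
      rw [this] at hJ; norm_num at hJ
  set P := 4 * Y.natAbs with hP
  have h1 : ∑ j ∈ Finset.range P, chiY Y j = ∑ x : ZMod P, chiY Y x.val := by
    rw [← sum_range_zmod]
    refine Finset.sum_congr rfl fun j hj => ?_
    rw [ZMod.val_natCast, Nat.mod_eq_of_lt (by simpa using hj)]
  have h2 : ∑ x : ZMod P, chiY Y x.val = ∑ x : ZMod P, - chiY Y x.val := by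
    symm
    refine Fintype.sum_equiv (Units.mulLeft (ZMod.unitOfCoprime n hcop)) _ _ fun x => ?_
    simp only [Units.mulLeft_apply, ZMod.coe_unitOfCoprime]
    have : ((n : ZMod P) * x).val = (n * x.val) % P := by
      conv_lhs => rw [← ZMod.natCast_zmod_val x, ← Nat.cast_mul, ZMod.val_natCast]
    rw [this, chiY_mod, chiY_mul, hchi]; ring
  rw [Finset.sum_neg_distrib] at h2
  rw [h1]; linarith

lemma chiY_partial_bound (Y : ℤ) (hY : ¬ IsSquare Y) (x : ℕ) :
    |∑ j ∈ Finset.range x, chiY Y j| ≤ 4 * Y.natAbs := by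
  have hY0 : Y ≠ 0 := by rintro rfl; exact hY (by simp)
  have hpos := Int.natAbs_pos.2 hY0
  set P := 4 * Y.natAbs with hP
  have hx : x = (x / P) * P + x % P := by rw [mul_comm]; exact (Nat.div_add_mod x P).symm
  have hper : ∀ k j, chiY Y (k * P + j) = chiY Y j := by
    intro k j
    rw [← chiY_mod, ← chiY_mod Y j, ← hP, Nat.mul_add_mod']
  rw [hx, Finset.sum_range_add, sum_range_periodic P _ (chiY_periodic Y), chiY_sum_period Y hY, smul_zero,
    zero_add]
  simp_rw [hper]
  refine le_trans (Finset.abs_sum_le_sum_abs _ _) (le_trans (Finset.sum_le_sum fun j _ => abs_chiY_le Y j) ?_)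
  simp only [Finset.sum_const, Finset.card_range, nsmul_eq_mul, mul_one]
  have : x % P ≤ P := (Nat.mod_lt _ (by omega)).le
  calc ((x % P : ℕ) : ℝ) ≤ ((P : ℕ) : ℝ) := by exact_mod_cast this
    _ = _ := by rw [hP]; push_cast; ring

lemma abel_inv (a : ℕ → ℝ) (X : ℕ) :
    ∑ e ∈ Finset.Ioc 0 X, a e / e =
      (∑ j ∈ Finset.Ioc 0 X, a j) / (X + 1) +
        ∑ e ∈ Finset.Ioc 0 X, (∑ j ∈ Finset.Ioc 0 e, a j) / ((e : ℝ) * (e + 1)) := by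
  induction X with
  | zero => simp
  | succ X ih =>
    rw [Finset.sum_Ioc_succ_top (Nat.zero_le X), Finset.sum_Ioc_succ_top (Nat.zero_le X),
      Finset.sum_Ioc_succ_top (Nat.zero_le X), ih, Finset.sum_Ioc_succ_top (Nat.zero_le X)]
    push_cast
    have h1 : (X : ℝ) + 1 ≠ 0 := by positivity
    have h2 : (X : ℝ) + 1 + 1 ≠ 0 := by positivity
    field_simp
    ring

lemma chiY_Ioc_bound (Y : ℤ) (hY : ¬ IsSquare Y) (x : ℕ) :
    |∑ j ∈ Finset.Ioc 0 x, chiY Y j| ≤ 4 * Y.natAbs := by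
  have h := chiY_partial_bound Y hY (x + 1)
  rw [Finset.range_eq_Ico, Finset.sum_eq_sum_Ico_succ_bot (by omega)] at h
  have h0 : chiY Y 0 = 0 := by simp [chiY]
  rw [h0, zero_add] at h
  have : Finset.Ioc 0 x = Finset.Ico (0 + 1) (x + 1) := by ext; simp; omega
  rw [this]; exact h

lemma chiY_Ioc_triv (Y : ℤ) (x : ℕ) :
    |∑ j ∈ Finset.Ioc 0 x, chiY Y j| ≤ x := by
  refine (Finset.abs_sum_le_sum_abs _ _).trans ?_
  refine (Finset.sum_le_sum fun i _ => abs_chiY_le Y i).trans ?_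
  simp

lemma summable_rp : Summable fun e : ℕ => (e : ℝ) ^ (-(65 / 64 : ℝ)) := by
  rw [Real.summable_nat_rpow]; norm_num

/-- Truncated `L(1, χ)`. -/
lemma L_bound : ∃ C : ℝ, 0 < C ∧ ∀ Y : ℤ, ¬ IsSquare Y → ∀ X : ℕ,
    |∑ e ∈ Finset.Ioc 0 X, chiY Y e / e| ≤ C * (Y.natAbs : ℝ) ^ (1 / 64 : ℝ) := by
  refine ⟨(1 + ∑' e : ℕ, (e : ℝ) ^ (-(65 / 64 : ℝ))) * 4 ^ (1 / 64 : ℝ), ?_, ?_⟩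
  · have : 0 ≤ ∑' e : ℕ, (e : ℝ) ^ (-(65 / 64 : ℝ)) := tsum_nonneg fun _ => by positivity
    positivity
  intro Y hY X
  have hY0 : Y ≠ 0 := by rintro rfl; exact hY (by simp)
  have hY1 : (1 : ℝ) ≤ Y.natAbs := by exact_mod_cast Int.natAbs_pos.2 hY0
  set P : ℝ := 4 * Y.natAbs with hP
  have hP1 : 1 ≤ P := by linarith
  have hPd : 1 ≤ P ^ (1 / 64 : ℝ) := Real.one_le_rpow hP1 (by norm_num)
  rw [mul_assoc, ← Real.mul_rpow (by norm_num) (by positivity), ← hP, abel_inv]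
  refine (abs_add_le _ _).trans ?_
  rw [add_mul, one_mul]
  refine add_le_add ?_ ?_
  · rw [abs_div, abs_of_pos (by positivity : (0 : ℝ) < X + 1)]
    refine le_trans ?_ hPd
    rw [div_le_one (by positivity)]
    exact (chiY_Ioc_triv Y X).trans (by linarith)
  · refine (Finset.abs_sum_le_sum_abs _ _).trans ?_
    have : ∀ e ∈ Finset.Ioc 0 X, |(∑ j ∈ Finset.Ioc 0 e, chiY Y j) / ((e : ℝ) * (e + 1))| ≤
        (e : ℝ) ^ (-(65 / 64 : ℝ)) * P ^ (1 / 64 : ℝ) := by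
      intro e he
      have he0 : (0 : ℝ) < e := by exact_mod_cast (Finset.mem_Ioc.1 he).1
      rw [abs_div, abs_of_pos (by positivity : (0 : ℝ) < (e : ℝ) * (e + 1)), div_le_iff₀ (by positivity)]
      have h1 := chiY_Ioc_triv Y e
      have h2 := chiY_Ioc_bound Y hY e
      set B := |∑ j ∈ Finset.Ioc 0 e, chiY Y j| with hB
      have hB0 : 0 ≤ B := abs_nonneg _
      have h3 : B ≤ (e : ℝ) ^ (63 / 64 : ℝ) * P ^ (1 / 64 : ℝ) := by
        calc B = B ^ (63 / 64 : ℝ) * B ^ (1 / 64 : ℝ) := by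
              rw [← Real.rpow_add_of_nonneg hB0 (by norm_num) (by norm_num)]; norm_num
          _ ≤ _ := by gcongr
      refine h3.trans ?_
      have h4 : (e : ℝ) ^ (63 / 64 : ℝ) = (e : ℝ) ^ (-(65 / 64 : ℝ)) * (e * e) := by
        have : (e : ℝ) * e = (e : ℝ) ^ (2 : ℝ) := by rw [Real.rpow_two]; ring
        rw [this, ← Real.rpow_add he0]; norm_num
      rw [h4]
      have h5 : 0 ≤ (e : ℝ) ^ (-(65 / 64 : ℝ)) * P ^ (1 / 64 : ℝ) := by positivity
      nlinarith
    refine (Finset.sum_le_sum this).trans ?_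
    rw [← Finset.sum_mul]
    gcongr
    exact summable_rp.sum_le_tsum _ fun _ _ => by positivity

/-- the arithmetic function `μ(d) χ(d) / d²`. -/
noncomputable def afF (Y : ℤ) : ArithmeticFunction ℝ :=
  ⟨fun d => (ArithmeticFunction.moebius d : ℝ) * chiY Y d / (d : ℝ) ^ 2, by simp⟩

/-- the arithmetic function `χ(e) / e`. -/
noncomputable def afG (Y : ℤ) : ArithmeticFunction ℝ :=
  ⟨fun d => chiY Y d / (d : ℝ), by simp⟩

/-- the arithmetic function `χ(n) φ(n) / n²`. -/
noncomputable def afH (Y : ℤ) : ArithmeticFunction ℝ :=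
  ⟨fun d => chiY Y d * (Nat.totient d : ℝ) / (d : ℝ) ^ 2, by simp⟩

lemma totient_moebius (n : ℕ) (hn : 0 < n) :
    ∑ x ∈ n.divisorsAntidiagonal, (ArithmeticFunction.moebius x.1 : ℝ) * (x.2 : ℝ) =
      (Nat.totient n : ℝ) := by
  have := (ArithmeticFunction.sum_eq_iff_sum_mul_moebius_eq (R := ℝ)
    (f := fun n => (Nat.totient n : ℝ)) (g := fun n => (n : ℝ))).1 (fun n _ => by
      have := Nat.sum_totient n
      exact_mod_cast this) n hn
  exact this

lemma afH_eq (Y : ℤ) : afH Y = afF Y * afG Y := by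
  ext n
  rcases Nat.eq_zero_or_pos n with rfl | hn
  · simp
  rw [ArithmeticFunction.mul_apply]
  show chiY Y n * (Nat.totient n : ℝ) / (n : ℝ) ^ 2 = _
  rw [← totient_moebius n hn, Finset.mul_sum, Finset.sum_div]
  refine Finset.sum_congr rfl fun x hx => ?_
  obtain ⟨hx1, hx0⟩ := Nat.mem_divisorsAntidiagonal.1 hx
  show _ = ((ArithmeticFunction.moebius x.1 : ℝ) * chiY Y x.1 / (x.1 : ℝ) ^ 2) * (chiY Y x.2 / (x.2 : ℝ))
  have h1 : (x.1 : ℝ) ≠ 0 := by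
    intro h; have h : x.1 = 0 := by exact_mod_cast h
    rw [h] at hx1; omega
  have h2 : (x.2 : ℝ) ≠ 0 := by
    intro h; have h : x.2 = 0 := by exact_mod_cast h
    rw [h] at hx1; omega
  rw [← hx1, chiY_mul]
  push_cast
  field_simp

lemma H_bound : ∃ C : ℝ, 0 < C ∧ ∀ Y : ℤ, ¬ IsSquare Y → ∀ X : ℕ,
    |∑ e ∈ Finset.Ioc 0 X, afH Y e| ≤ C * (Y.natAbs : ℝ) ^ (1 / 64 : ℝ) := by
  obtain ⟨C, hC, h⟩ := L_bound
  have hs : Summable fun n : ℕ => 1 / (n : ℝ) ^ 2 := Real.summable_one_div_nat_pow.2 (by norm_num)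
  have hs0 : 0 ≤ ∑' n : ℕ, 1 / (n : ℝ) ^ 2 := tsum_nonneg fun _ => by positivity
  refine ⟨(1 + ∑' n : ℕ, 1 / (n : ℝ) ^ 2) * C, by positivity, fun Y hY X => ?_⟩
  rw [afH_eq, ArithmeticFunction.sum_Ioc_mul_eq_sum_sum]
  refine (Finset.abs_sum_le_sum_abs _ _).trans ?_
  have : ∀ n ∈ Finset.Ioc 0 X, |afF Y n * ∑ m ∈ Finset.Ioc 0 (X / n), afG Y m| ≤
      1 / (n : ℝ) ^ 2 * (C * (Y.natAbs : ℝ) ^ (1 / 64 : ℝ)) := by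
    intro n hn
    rw [abs_mul]
    refine mul_le_mul ?_ (h Y hY _) (abs_nonneg _) (by positivity)
    show |(ArithmeticFunction.moebius n : ℝ) * chiY Y n / (n : ℝ) ^ 2| ≤ _
    rw [abs_div, abs_mul, abs_of_nonneg (by positivity : (0 : ℝ) ≤ (n : ℝ) ^ 2)]
    gcongr
    have h1 : |(ArithmeticFunction.moebius n : ℝ)| ≤ 1 := by
      exact_mod_cast ArithmeticFunction.abs_moebius_le_one (n := n)
    exact mul_le_one₀ h1 (abs_nonneg _) (abs_chiY_le Y n)
  refine (Finset.sum_le_sum this).trans ?_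
  rw [← Finset.sum_mul, mul_assoc]
  gcongr
  have := hs.sum_le_tsum (Finset.Ioc 0 X) fun _ _ => by positivity
  linarith

/-- `q` is composed only of primes dividing `N`. -/
def Fac (N q : ℕ) : Prop := q ∈ Nat.factoredNumbers N.primeFactors

lemma Fac_iff (N q : ℕ) (hN : N ≠ 0) : Fac N q ↔ q ≠ 0 ∧ ∀ p : ℕ, p.Prime → p ∣ q → p ∣ N := by
  unfold Fac
  rw [Nat.mem_factoredNumbers_iff_primeFactors_subset]
  constructor
  · rintro ⟨h0, h⟩
    refine ⟨h0, fun p hp hpq => ?_⟩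
    exact Nat.dvd_of_mem_primeFactors (h (Nat.mem_primeFactors.2 ⟨hp, hpq, h0⟩))
  · rintro ⟨h0, h⟩
    refine ⟨h0, fun p hp => ?_⟩
    obtain ⟨h1, h2, h3⟩ := Nat.mem_primeFactors.1 hp
    exact Nat.mem_primeFactors.2 ⟨h1, h p h1 h2, hN⟩

lemma Fac_coprime (N m n : ℕ) (hN : N ≠ 0) (hm : Fac N m) (hn : Nat.Coprime n N) : Nat.Coprime m n := by
  rw [Fac_iff N m hN] at hm
  refine Nat.Coprime.symm (Nat.coprime_of_dvd fun p hp hpn hpm => ?_)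
  have h1 := hm.2 p hp hpm
  have := Nat.dvd_gcd hpn h1
  rw [hn] at this
  exact hp.one_lt.ne' (Nat.dvd_one.1 this)

lemma Fac_split (N : ℕ) (hN : N ≠ 0) (q : ℕ) (hq : q ≠ 0) :
    ∃ m n, q = m * n ∧ Fac N m ∧ Nat.Coprime n N := by
  induction q using induction_on_primes with
  | zero => exact absurd rfl hq
  | one => exact ⟨1, 1, rfl, (Fac_iff N 1 hN).2 ⟨one_ne_zero, fun p hp h => absurd (Nat.dvd_one.1 h) hp.one_lt.ne'⟩, by simp⟩
  | prime_mul p a hp ih =>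
    obtain ⟨m, n, rfl, hm, hn⟩ := ih (by rintro rfl; simp at hq)
    by_cases h : p ∣ N
    · refine ⟨p * m, n, by ring, ?_, hn⟩
      rw [Fac_iff N _ hN] at hm ⊢
      refine ⟨mul_ne_zero hp.ne_zero hm.1, fun r hr hd => ?_⟩
      rcases (hr.dvd_mul).1 hd with h' | h'
      · rw [(Nat.prime_dvd_prime_iff_eq hr hp).1 h']; exact h
      · exact hm.2 r hr h'
    · refine ⟨m, p * n, by ring, hm, ?_⟩
      exact Nat.Coprime.mul_left ((Nat.Prime.coprime_iff_not_dvd hp).2 h) hn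

/-- local part of the singular series. -/
noncomputable def afL (a : Fin 4 → ℤ) (N : ℕ) : ArithmeticFunction ℂ :=
  ⟨fun q => if Fac N q then (1 / (q : ℂ) ^ 4) * Sqa a 0 q else 0, by simp⟩

/-- complex version of `afH`. -/
noncomputable def afHC (Y : ℤ) : ArithmeticFunction ℂ :=
  ⟨fun q => ((afH Y q : ℝ) : ℂ), by simp⟩

lemma afH_eq_zero (Y : ℤ) (hY : Y ≠ 0) (n : ℕ) (hn : ¬ Nat.Coprime n (2 * Y.natAbs)) : afH Y n = 0 := by
  have : chiY Y n = 0 := by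
    unfold chiY
    split_ifs with h
    · have hg : Int.gcd Y n ≠ 1 := by
        intro hg
        apply hn
        refine Nat.Coprime.mul_right (Nat.coprime_two_right.2 h) ?_
        have : Int.gcd Y n = Nat.gcd Y.natAbs n := by rw [Int.gcd_def]; simp
        rw [Nat.Coprime, Nat.gcd_comm, ← this, hg]
      have : NeZero n := ⟨by rintro rfl; simp at h⟩
      have := (jacobiSym.eq_zero_iff_not_coprime (a := Y) (b := n)).2 hg
      rw [this]; simp
    · rfl
  show chiY Y n * _ / _ = 0
  rw [this]; simp

lemma f_eq_mul (a : Fin 4 → ℤ) (Y : ℤ) (hY : Y ≠ 0)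
    (h1 : ∀ q : ℕ, Nat.Coprime q (2 * Y.natAbs) → Int.gcd (∏ i, a i) q = 1 ∧ J(∏ i, a i | q) = J(Y | q))
    (q : ℕ) (hq : q ≠ 0) :
    (1 / (q : ℂ) ^ 4) * Sqa a 0 q = (afL a (2 * Y.natAbs) * afHC Y) q := by
  have hN : 2 * Y.natAbs ≠ 0 := by have := Int.natAbs_pos.2 hY; omega
  set N := 2 * Y.natAbs with hNd
  obtain ⟨m, n, rfl, hm, hn⟩ := Fac_split N hN q hq
  have hm0 : m ≠ 0 := by rintro rfl; simp at hq
  have hn0 : n ≠ 0 := by rintro rfl; simp at hq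
  rw [ArithmeticFunction.mul_apply, Finset.sum_eq_single (m, n)]
  · show _ = (if Fac N m then (1 / (m : ℂ) ^ 4) * Sqa a 0 m else 0) *
      ((chiY Y n * (Nat.totient n : ℝ) / (n : ℝ) ^ 2 : ℝ) : ℂ)
    have : NeZero m := ⟨hm0⟩
    have : NeZero n := ⟨hn0⟩
    have ho : Odd n := by
      rw [← Nat.coprime_two_right]
      exact hn.coprime_dvd_right ⟨_, hNd⟩
    rw [if_pos hm, Sqa_mul a m n (Fac_coprime N m n hN hm hn) ho (h1 n hn).1, (h1 n hn).2]
    unfold chiY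
    rw [if_pos ho]
    have hm' : (m : ℂ) ≠ 0 := by exact_mod_cast hm0
    have hn' : (n : ℂ) ≠ 0 := by exact_mod_cast hn0
    push_cast
    field_simp
  · rintro ⟨m', n'⟩ hx hne
    show (if Fac N m' then (1 / (m' : ℂ) ^ 4) * Sqa a 0 m' else 0) * ((afH Y n' : ℝ) : ℂ) = 0
    by_cases hm' : Fac N m'
    · by_cases hn' : Nat.Coprime n' N
      · exfalso
        apply hne
        have hx1 : m' * n' = m * n := (Nat.mem_divisorsAntidiagonal.1 hx).1
        have d1 : m' ∣ m := by
          refine (Fac_coprime N m' n hN hm' hn).dvd_of_dvd_mul_right ?_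
          rw [← hx1]; exact dvd_mul_right _ _
        have d2 : m ∣ m' := by
          refine (Fac_coprime N m n' hN hm hn').dvd_of_dvd_mul_right ?_
          rw [hx1]; exact dvd_mul_right _ _
        have := Nat.dvd_antisymm d1 d2
        subst this
        have : n' = n := Nat.eq_of_mul_eq_mul_left (Nat.pos_of_ne_zero hm0) hx1
        rw [this]
      · rw [afH_eq_zero Y hY n' hn']; simp
    · rw [if_neg hm', zero_mul]
  · intro h
    exact absurd (Nat.mem_divisorsAntidiagonal.2 ⟨rfl, hq⟩) h

lemma singular_bound (a : Fin 4 → ℤ) (Y : ℤ) (hY : Y ≠ 0) (B : ℝ)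
    (hB : ∀ X : ℕ, |∑ e ∈ Finset.Ioc 0 X, afH Y e| ≤ B)
    (h1 : ∀ q : ℕ, Nat.Coprime q (2 * Y.natAbs) → Int.gcd (∏ i, a i) q = 1 ∧ J(∏ i, a i | q) = J(Y | q))
    (T : ℕ) :
    ‖singularPartial a T‖ ≤ (∑ q ∈ (Finset.Ioc 0 T).filter (Fac (2 * Y.natAbs)),
      4 * ((q : ℝ)⁻¹ * ∏ i, Real.sqrt (Int.gcd (a i) q))) * B := by
  have e1 : singularPartial a T = ∑ q ∈ Finset.Ioc 0 T, (afL a (2 * Y.natAbs) * afHC Y) q := by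
    unfold singularPartial
    have : Finset.Icc 1 T = Finset.Ioc 0 T := by ext; simp; omega
    rw [this]
    refine Finset.sum_congr rfl fun q hq => f_eq_mul a Y hY h1 q ?_
    have := (Finset.mem_Ioc.1 hq).1; omega
  rw [e1, ArithmeticFunction.sum_Ioc_mul_eq_sum_sum, Finset.sum_filter, Finset.sum_mul]
  refine (norm_sum_le _ _).trans (Finset.sum_le_sum fun q hq => ?_)
  rw [norm_mul]
  have hB0 : 0 ≤ B := (abs_nonneg _).trans (hB 0)
  have h2 : ‖∑ m ∈ Finset.Ioc 0 (T / q), afHC Y m‖ ≤ B := by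
    have : ∑ m ∈ Finset.Ioc 0 (T / q), afHC Y m = ((∑ m ∈ Finset.Ioc 0 (T / q), afH Y m : ℝ) : ℂ) := by
      push_cast; rfl
    rw [this, Complex.norm_real]
    exact hB _
  refine mul_le_mul ?_ h2 (norm_nonneg _) ?_
  · show ‖if Fac (2 * Y.natAbs) q then (1 / (q : ℂ) ^ 4) * Sqa a 0 q else 0‖ ≤ _
    split_ifs with hF
    · have hq0 : q ≠ 0 := by have := (Finset.mem_Ioc.1 hq).1; omega
      have : NeZero q := ⟨hq0⟩
      have hq' : (0 : ℝ) < q := by exact_mod_cast Nat.pos_of_ne_zero hq0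
      rw [norm_mul]
      have := norm_Sqa_le a q
      have e : ‖(1 / (q : ℂ) ^ 4)‖ = 1 / (q : ℝ) ^ 4 := by simp
      rw [e]
      calc _ ≤ 1 / (q : ℝ) ^ 4 * (4 * (q:ℝ)^3 * ∏ i, Real.sqrt (Int.gcd (a i) q)) := by gcongr
        _ = _ := by field_simp
    · simp
  · split_ifs
    · positivity
    · rfl

/-- the radical, as a product of prime factors. -/
def radN (m : ℕ) : ℕ := ∏ p ∈ m.primeFactors, p

lemma radN_pos (m : ℕ) : 0 < radN m := Finset.prod_pos fun _ hp => (Nat.prime_of_mem_primeFactors hp).pos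

lemma radN_squarefree (m : ℕ) : Squarefree (radN m) := by
  unfold radN
  refine Finset.squarefree_prod_of_pairwise_isCoprime (fun p hp q hq hpq => ?_)
    fun p hp => (Nat.prime_of_mem_primeFactors hp).squarefree
  show IsRelPrime p q
  rw [← Nat.coprime_iff_isRelPrime]
  exact (Nat.coprime_primes (Nat.prime_of_mem_primeFactors hp) (Nat.prime_of_mem_primeFactors hq)).2 hpq

lemma radN_primeFactors (m : ℕ) : (radN m).primeFactors = m.primeFactors :=
  Nat.primeFactors_prod fun _ hp => Nat.prime_of_mem_primeFactors hp

lemma dvd_radN (m : ℕ) (p : ℕ) (hp : p.Prime) (hm : m ≠ 0) : p ∣ radN m ↔ p ∣ m := by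
  have h := radN_primeFactors m
  have : p ∈ (radN m).primeFactors ↔ p ∈ m.primeFactors := by rw [h]
  rw [Nat.mem_primeFactors, Nat.mem_primeFactors] at this
  have h0 := (radN_pos m).ne'
  tauto

lemma sqf_dvd_radN (m d : ℕ) (hm : m ≠ 0) (hd : Squarefree d) (h : ∀ p : ℕ, p.Prime → p ∣ d → p ∣ m) :
    d ∣ radN m := by
  rw [← Nat.prod_primeFactors_of_squarefree hd]
  unfold radN
  refine Finset.prod_dvd_prod_of_subset _ _ _ fun p hp => ?_
  obtain ⟨h1, h2, h3⟩ := Nat.mem_primeFactors.1 hp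
  exact Nat.mem_primeFactors.2 ⟨h1, h p h1 h2, hm⟩

lemma key_ineq (k b s1 s2 s3 s4 a1 a2 a3 a4 : ℕ) (hs1 : s1 ≤ 1) (hs2 : s2 ≤ 1) (hs3 : s3 ≤ 1) (hs4 : s4 ≤ 1)
    (ha1 : a1 ≤ 1) (ha2 : a2 ≤ 1) (ha3 : a3 ≤ 1) (ha4 : a4 ≤ 1)
    (hb : b ≤ 1) (hb0 : a1 + a2 + a3 + a4 = 0 → b = 0)
    (h : s1 + s2 + s3 + s4 ≠ 0 → 1 ≤ s1 + a1 ∧ 1 ≤ s2 + a2 ∧ 1 ≤ s3 + a3 ∧ 1 ≤ s4 + a4 ∧ s1 + s2 + s3 + s4 ≤ 3) :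
    10 * b + (4 * min (2 * s1 + 3 * a1) k + 4 * min (2 * s2 + 3 * a2) k
      + 4 * min (2 * s3 + 3 * a3) k + 4 * min (2 * s4 + 3 * a4) k) ≤
    7 * k + 8 * (s1 + s2 + s3 + s4) + 10 * (a1 + a2 + a3 + a4) := by
  interval_cases s1 <;> interval_cases a1 <;> interval_cases s2 <;> interval_cases a2 <;>
  interval_cases s3 <;> interval_cases a3 <;> interval_cases s4 <;> interval_cases a4 <;>
  omega

lemma key_dvd (z s : Fin 4 → ℕ) (hz : ∀ i, Squarefree (z i)) (hs : ∀ i, Squarefree (s i))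
    (h1 : ∀ p : ℕ, p.Prime → p ∣ ∏ i, s i → ∀ j, p ∣ s j * z j)
    (h2 : ∀ p : ℕ, p.Prime → ¬ ∀ j, p ∣ s j) (q : ℕ) (hq : q ≠ 0) :
    radN (∏ i, z i) ^ 10 * ∏ i, (Nat.gcd (s i ^ 2 * z i ^ 3) q) ^ 4 ∣
      q ^ 7 * (∏ i, s i) ^ 8 * (∏ i, z i) ^ 10 := by
  have hz0 : ∀ i, z i ≠ 0 := fun i => (hz i).ne_zero
  have hs0 : ∀ i, s i ≠ 0 := fun i => (hs i).ne_zero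
  have hZ : ∏ i, z i ≠ 0 := Finset.prod_ne_zero_iff.2 fun i _ => hz0 i
  have hS : ∏ i, s i ≠ 0 := Finset.prod_ne_zero_iff.2 fun i _ => hs0 i
  have hr := (radN_pos (∏ i, z i)).ne'
  have hg : ∀ i, Nat.gcd (s i ^ 2 * z i ^ 3) q ≠ 0 := fun i => Nat.gcd_ne_zero_right hq
  have hG : ∏ i, (Nat.gcd (s i ^ 2 * z i ^ 3) q) ^ 4 ≠ 0 :=
    Finset.prod_ne_zero_iff.2 fun i _ => pow_ne_zero _ (hg i)
  rw [← Nat.factorization_prime_le_iff_dvd (mul_ne_zero (pow_ne_zero _ hr) hG)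
    (mul_ne_zero (mul_ne_zero (pow_ne_zero _ hq) (pow_ne_zero _ hS)) (pow_ne_zero _ hZ))]
  intro p hp
  have hgi : ∀ i, (Nat.gcd (s i ^ 2 * z i ^ 3) q).factorization p =
      min (2 * (s i).factorization p + 3 * (z i).factorization p) (q.factorization p) := by
    intro i
    rw [Nat.factorization_gcd (mul_ne_zero (pow_ne_zero _ (hs0 i)) (pow_ne_zero _ (hz0 i))) hq,
      Nat.factorization_mul (pow_ne_zero _ (hs0 i)) (pow_ne_zero _ (hz0 i))]
    simp
  rw [Nat.factorization_mul (pow_ne_zero _ hr) hG, Nat.factorization_mul (mul_ne_zero (pow_ne_zero _ hq) (pow_ne_zero _ hS)) (pow_ne_zero _ hZ),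
    Nat.factorization_mul (pow_ne_zero _ hq) (pow_ne_zero _ hS),
    Nat.factorization_prod fun i _ => pow_ne_zero _ (hg i)]
  have hSf : (∏ i, s i).factorization p = (s 0).factorization p + (s 1).factorization p + (s 2).factorization p + (s 3).factorization p := by
    rw [Nat.factorization_prod fun i _ => hs0 i]; simp [Fin.sum_univ_four]
  have hZf : (∏ i, z i).factorization p = (z 0).factorization p + (z 1).factorization p + (z 2).factorization p + (z 3).factorization p := by
    rw [Nat.factorization_prod fun i _ => hz0 i]; simp [Fin.sum_univ_four]
  simp only [Nat.factorization_pow, Fin.sum_univ_four, Finsupp.add_apply, Finsupp.smul_apply, smul_eq_mul, hgi, hSf, hZf]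
  have pos : ∀ m : ℕ, m ≠ 0 → (1 ≤ m.factorization p ↔ p ∣ m) := fun m hm =>
    (hp.dvd_iff_one_le_factorization hm).symm
  have l1 : ∀ m : ℕ, Squarefree m → m.factorization p ≤ 1 := fun m hm => hm.natFactorization_le_one p
  refine key_ineq _ _ _ _ _ _ _ _ _ _ (l1 _ (hs 0)) (l1 _ (hs 1)) (l1 _ (hs 2)) (l1 _ (hs 3))
    (l1 _ (hz 0)) (l1 _ (hz 1)) (l1 _ (hz 2)) (l1 _ (hz 3)) (l1 _ (radN_squarefree _)) ?_ ?_
  · intro h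
    have := (pos _ hr).trans (dvd_radN _ p hp hZ)
    have h3 := (pos _ hZ)
    rw [hZf] at h3
    by_contra hb
    have := h3.2 (this.1 (by omega))
    omega
  · intro h
    have h3 := h1 p hp ((pos _ hS).1 (by rw [hSf]; omega))
    have h4 : ∀ j, 1 ≤ (s j).factorization p + (z j).factorization p := fun j => by
      have := (pos _ (mul_ne_zero (hs0 j) (hz0 j))).2 (h3 j)
      rwa [Nat.factorization_mul (hs0 j) (hz0 j)] at this
    refine ⟨h4 0, h4 1, h4 2, h4 3, ?_⟩
    by_contra h5
    apply h2 p hp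
    intro j
    rw [← pos _ (hs0 j)]
    have g0 := l1 _ (hs 0)
    have g1 := l1 _ (hs 1)
    have g2 := l1 _ (hs 2)
    have g3 := l1 _ (hs 3)
    fin_cases j <;> simp <;> omega

lemma key_real (z s : Fin 4 → ℕ) (hz : ∀ i, Squarefree (z i)) (hs : ∀ i, Squarefree (s i))
    (h1 : ∀ p : ℕ, p.Prime → p ∣ ∏ i, s i → ∀ j, p ∣ s j * z j)
    (h2 : ∀ p : ℕ, p.Prime → ¬ ∀ j, p ∣ s j) (q : ℕ) (hq : q ≠ 0) :
    (q : ℝ)⁻¹ * ∏ i, Real.sqrt (Nat.gcd (s i ^ 2 * z i ^ 3) q : ℕ) ≤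
      (q : ℝ) ^ (-(1 / 8) : ℝ) * (((∏ i, s i : ℕ) : ℝ) * ((∏ i, z i : ℕ) : ℝ) ^ (5 / 4 : ℝ) *
        ((radN (∏ i, z i) : ℕ) : ℝ) ^ (-(5 / 4) : ℝ)) := by
  have hS : ∏ i, s i ≠ 0 := Finset.prod_ne_zero_iff.2 fun i _ => (hs i).ne_zero
  have hZ : ∏ i, z i ≠ 0 := Finset.prod_ne_zero_iff.2 fun i _ => (hz i).ne_zero
  have hle := Nat.le_of_dvd (by positivity) (key_dvd z s hz hs h1 h2 q hq)
  have hle' : (radN (∏ i, z i) : ℝ) ^ 10 * (∏ i, ((Nat.gcd (s i ^ 2 * z i ^ 3) q : ℕ) : ℝ) ^ 4) ≤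
      (q : ℝ) ^ 7 * ((∏ i, s i : ℕ) : ℝ) ^ 8 * ((∏ i, z i : ℕ) : ℝ) ^ 10 := by exact_mod_cast hle
  set g : ℝ := ∏ i, Real.sqrt (Nat.gcd (s i ^ 2 * z i ^ 3) q : ℕ) with hgdef
  have hg0 : 0 ≤ g := Finset.prod_nonneg fun _ _ => Real.sqrt_nonneg _
  have hg8 : (∏ i, ((Nat.gcd (s i ^ 2 * z i ^ 3) q : ℕ) : ℝ) ^ 4) = g ^ 8 := by
    rw [hgdef, ← Finset.prod_pow]
    refine Finset.prod_congr rfl fun i _ => ?_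
    rw [show 8 = 2 * 4 by norm_num, pow_mul, Real.sq_sqrt (Nat.cast_nonneg _)]
  rw [hg8] at hle'
  have hn : (0 : ℝ) < radN (∏ i, z i) := by exact_mod_cast radN_pos _
  have hS' : (0 : ℝ) < (∏ i, s i : ℕ) := by exact_mod_cast Nat.pos_of_ne_zero hS
  have hZ' : (0 : ℝ) < (∏ i, z i : ℕ) := by exact_mod_cast Nat.pos_of_ne_zero hZ
  have hq' : (0 : ℝ) < q := by exact_mod_cast Nat.pos_of_ne_zero hq
  generalize (radN (∏ i, z i) : ℝ) = n at *
  generalize ((∏ i, s i : ℕ) : ℝ) = S at *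
  generalize ((∏ i, z i : ℕ) : ℝ) = Z at *
  generalize (q : ℝ) = Q at *
  refine le_of_pow_le_pow_left₀ (n := 8) (by norm_num) (by positivity) ?_
  have e1 : (Q ^ (-(1 / 8) : ℝ)) ^ 8 = Q⁻¹ := by
    rw [← Real.rpow_natCast, ← Real.rpow_mul hq'.le, ← Real.rpow_neg_one]; norm_num
  have e2 : (Z ^ (5 / 4 : ℝ)) ^ 8 = Z ^ 10 := by
    rw [← Real.rpow_natCast, ← Real.rpow_mul hZ'.le, ← Real.rpow_natCast]; norm_num
  have e3 : (n ^ (-(5 / 4) : ℝ)) ^ 8 = (n ^ 10)⁻¹ := by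
    rw [← Real.rpow_natCast, ← Real.rpow_mul hn.le, ← Real.rpow_natCast, ← Real.rpow_neg hn.le]; norm_num
  rw [mul_pow, mul_pow, mul_pow, mul_pow, e1, e2, e3, inv_pow]
  rw [inv_mul_le_iff₀ (by positivity)]
  have : Q ^ 8 * (Q⁻¹ * (S ^ 8 * Z ^ 10 * (n ^ 10)⁻¹)) = (Q ^ 7 * S ^ 8 * Z ^ 10) / n ^ 10 := by
    field_simp
  rw [this, le_div_iff₀ (by positivity)]
  linarith

/-- the monoid hom `n ↦ n^{-1/8}`. -/
noncomputable def rp8 : ℕ →* ℝ where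
  toFun n := (n : ℝ) ^ (-(1 / 8) : ℝ)
  map_one' := by simp
  map_mul' m n := by push_cast; rw [Real.mul_rpow (by positivity) (by positivity)]

lemma fac_sum : ∃ K : ℝ, 1 ≤ K ∧ ∀ N : ℕ, ∀ T : ℕ,
    ∑ q ∈ (Finset.Ioc 0 T).filter (Fac N), (q : ℝ) ^ (-(1 / 8) : ℝ) ≤ K ^ N.primeFactors.card := by
  have hlt : ∀ {p : ℕ}, p.Prime → (p : ℝ) ^ (-(1 / 8) : ℝ) ≤ 2 ^ (-(1 / 8) : ℝ) := by
    intro p hp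
    refine Real.rpow_le_rpow_of_nonpos (by norm_num) (by exact_mod_cast hp.two_le) (by norm_num)
  have h2 : (2 : ℝ) ^ (-(1 / 8) : ℝ) < 1 := Real.rpow_lt_one_of_one_lt_of_neg (by norm_num) (by norm_num)
  have h20 : (0 : ℝ) < (2 : ℝ) ^ (-(1 / 8) : ℝ) := by positivity
  refine ⟨(1 - (2 : ℝ) ^ (-(1 / 8) : ℝ))⁻¹, ?_, fun N T => ?_⟩
  · rw [one_le_inv₀ (by linarith)]; linarith
  have hs := (EulerProduct.summable_and_hasSum_factoredNumbers_prod_filter_prime_geometric (f := rp8)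
    (fun {p} hp => by
      show ‖(p : ℝ) ^ (-(1 / 8) : ℝ)‖ < 1
      rw [Real.norm_of_nonneg (by positivity)]
      exact (hlt hp).trans_lt h2) N.primeFactors).2
  have hs' := hasSum_subtype_iff_indicator.1 hs
  have h3 := sum_le_hasSum ((Finset.Ioc 0 T).filter (Fac N)) (fun i _ => by
    by_cases hi : i ∈ Nat.factoredNumbers N.primeFactors
    · rw [Set.indicator_of_mem hi]; show 0 ≤ (i : ℝ) ^ (-(1 / 8) : ℝ); positivity
    · rw [Set.indicator_of_notMem hi]) hs'
  have h4 : ∑ q ∈ (Finset.Ioc 0 T).filter (Fac N), (q : ℝ) ^ (-(1 / 8) : ℝ) =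
      ∑ i ∈ (Finset.Ioc 0 T).filter (Fac N), (Nat.factoredNumbers N.primeFactors).indicator (fun m => rp8 m) i := by
    refine Finset.sum_congr rfl fun i hi => ?_
    have hi' : i ∈ Nat.factoredNumbers N.primeFactors := (Finset.mem_filter.1 hi).2
    rw [Set.indicator_of_mem hi']; rfl
  rw [h4]
  refine h3.trans ?_
  have h5 : N.primeFactors.filter Nat.Prime = N.primeFactors :=
    Finset.filter_true_of_mem fun p hp => Nat.prime_of_mem_primeFactors hp
  rw [h5]
  rw [← Finset.prod_const]
  refine Finset.prod_le_prod (fun p hp => ?_) fun p hp => ?_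
  · show 0 ≤ (1 - (p : ℝ) ^ (-(1 / 8) : ℝ))⁻¹
    have := hlt (Nat.prime_of_mem_primeFactors hp)
    exact inv_nonneg.2 (by linarith)
  · show (1 - (p : ℝ) ^ (-(1 / 8) : ℝ))⁻¹ ≤ _
    have := hlt (Nat.prime_of_mem_primeFactors hp)
    exact inv_anti₀ (by linarith) (by linarith)

lemma isSquare_of_mul_sq (b Y : ℤ) (hb : b ≠ 0) (h : IsSquare (b ^ 2 * Y)) : IsSquare Y := by
  obtain ⟨w, hw⟩ := h
  have : b ^ 2 ∣ w ^ 2 := ⟨Y, by rw [hw]; ring⟩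
  obtain ⟨c, rfl⟩ := (Int.pow_dvd_pow_iff (by norm_num)).1 this
  refine ⟨c, ?_⟩
  have : b ^ 2 * Y = b ^ 2 * (c * c) := by rw [hw]; ring
  exact mul_left_cancel₀ (pow_ne_zero 2 hb) this

lemma prod_sq_cube (s : Fin 4 → ℕ) (y : Fin 4 → ℤ) :
    ∏ i, (s i : ℤ) ^ 2 * y i ^ 3 = (((∏ i, s i : ℕ) : ℤ) * ∏ i, y i) ^ 2 * ∏ i, y i := by
  simp only [Fin.prod_univ_four]; push_cast; ring

/-- Bound for the singular series. -/
lemma G_bound : ∃ C K : ℝ, 0 < C ∧ 1 ≤ K ∧ ∀ (s : Fin 4 → ℕ) (y : Fin 4 → ℤ) (g : ℂ),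
    ¬ IsSquare (∏ i, y i) → (∀ i, Squarefree (y i)) → (∀ i, Squarefree (s i)) →
    (∀ p : ℕ, p.Prime → p ∣ ∏ i, s i → ∀ j, p ∣ s j * (y j).natAbs) →
    (∀ p : ℕ, p.Prime → ¬ ∀ j, p ∣ s j) →
    (¬ IsSquare (∏ i, (s i : ℤ) ^ 2 * y i ^ 3) →
      Filter.Tendsto (singularPartial fun i => (s i : ℤ) ^ 2 * y i ^ 3) Filter.atTop (nhds g)) →
    ‖g‖ ≤ C * ((∏ i, y i).natAbs : ℝ) ^ (1 / 64 : ℝ) * K ^ ((∏ i, y i).natAbs).primeFactors.card *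
      (((∏ i, s i : ℕ) : ℝ) * ((∏ i, y i).natAbs : ℝ) ^ (5 / 4 : ℝ) *
        ((radN (∏ i, y i).natAbs : ℕ) : ℝ) ^ (-(5 / 4) : ℝ)) := by
  obtain ⟨C, hC, hH⟩ := H_bound
  obtain ⟨K, hK, hF⟩ := fac_sum
  refine ⟨4 * K * C, K, by positivity, hK, ?_⟩
  intro s y g hsq hy hs h1 h2 hg
  have hY0 : ∏ i, y i ≠ 0 := by intro h; rw [h] at hsq; exact hsq (by simp)
  have hS0 : ∏ i, s i ≠ 0 := Finset.prod_ne_zero_iff.2 fun i _ => (hs i).ne_zero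
  have hA := prod_sq_cube s y
  have hSY : ((∏ i, s i : ℕ) : ℤ) * ∏ i, y i ≠ 0 := mul_ne_zero (by exact_mod_cast hS0) hY0
  have hlim := hg (by rw [hA]; exact fun h => hsq (isSquare_of_mul_sq _ _ hSY h))
  set Y := ∏ i, y i with hYdef
  have hzY : ∏ i, (y i).natAbs = Y.natAbs := by
    rw [hYdef]; simp only [Fin.prod_univ_four, Int.natAbs_mul]
  have hSp : ∀ p : ℕ, p.Prime → p ∣ ∏ i, s i → p ∣ Y.natAbs := by
    intro p hp hd
    have := h2 p hp
    push Not at this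
    obtain ⟨j, hj⟩ := this
    have h3 := (hp.dvd_mul.1 (h1 p hp hd j)).resolve_left hj
    rw [← hzY]
    exact h3.trans (Finset.dvd_prod_of_mem _ (Finset.mem_univ j))
  have hco : ∀ q : ℕ, Nat.Coprime q (2 * Y.natAbs) →
      Int.gcd (((∏ i, s i : ℕ) : ℤ) * Y) q = 1 ∧ Int.gcd Y q = 1 := by
    intro q hq
    have hq1 : Nat.Coprime q Y.natAbs := hq.coprime_dvd_right (dvd_mul_left _ _)
    have hq2 : Nat.Coprime q (∏ i, s i) := by
      refine Nat.coprime_of_dvd fun p hp hpq hpS => ?_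
      have := Nat.dvd_gcd hpq (hSp p hp hpS)
      rw [hq1] at this
      exact hp.one_lt.ne' (Nat.dvd_one.1 this)
    constructor
    · rw [Int.gcd_def, Int.natAbs_mul, Int.natAbs_natCast, Int.natAbs_natCast]
      exact (Nat.Coprime.mul_right hq2 hq1).symm
    · rw [Int.gcd_def, Int.natAbs_natCast]; exact hq1.symm
  have hJ : ∀ q : ℕ, Nat.Coprime q (2 * Y.natAbs) →
      Int.gcd (∏ i, (s i : ℤ) ^ 2 * y i ^ 3) q = 1 ∧ J(∏ i, (s i : ℤ) ^ 2 * y i ^ 3 | q) = J(Y | q) := by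
    intro q hq
    obtain ⟨c1, c2⟩ := hco q hq
    rw [hA]
    constructor
    · have c1' := Int.isCoprime_iff_gcd_eq_one.2 c1
      have c2' := Int.isCoprime_iff_gcd_eq_one.2 c2
      exact Int.isCoprime_iff_gcd_eq_one.1 ((c1'.pow_left).mul_left c2')
    · rw [jacobiSym.mul_left, jacobiSym.sq_one' c1, one_mul]
  have hb := singular_bound (fun i => (s i : ℤ) ^ 2 * y i ^ 3) Y hY0 _ (hH Y hsq) hJ
  have hz : ∀ i, Squarefree (y i).natAbs := fun i => Int.squarefree_natAbs.2 (hy i)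
  have hgcd : ∀ (i : Fin 4) (q : ℕ), Int.gcd ((s i : ℤ) ^ 2 * y i ^ 3) q =
      Nat.gcd (s i ^ 2 * (y i).natAbs ^ 3) q := by
    intro i q
    rw [Int.gcd_def, Int.natAbs_mul, Int.natAbs_pow, Int.natAbs_pow, Int.natAbs_natCast, Int.natAbs_natCast]
  set M : ℝ := (((∏ i, s i : ℕ) : ℝ) * (Y.natAbs : ℝ) ^ (5 / 4 : ℝ) *
        ((radN Y.natAbs : ℕ) : ℝ) ^ (-(5 / 4) : ℝ)) with hM
  have hM0 : 0 ≤ M := by positivity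
  refine le_of_tendsto hlim.norm (Filter.Eventually.of_forall fun T => (hb T).trans ?_)
  have hsum : ∑ q ∈ (Finset.Ioc 0 T).filter (Fac (2 * Y.natAbs)),
      4 * ((q : ℝ)⁻¹ * ∏ i, Real.sqrt (Int.gcd ((s i : ℤ) ^ 2 * y i ^ 3) q)) ≤
      4 * K ^ (2 * Y.natAbs).primeFactors.card * M := by
    calc _ ≤ ∑ q ∈ (Finset.Ioc 0 T).filter (Fac (2 * Y.natAbs)), 4 * ((q : ℝ) ^ (-(1 / 8) : ℝ) * M) := by
          refine Finset.sum_le_sum fun q hq => ?_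
          have hq0 : q ≠ 0 := by
            have := (Finset.mem_Ioc.1 (Finset.mem_filter.1 hq).1).1; omega
          have := key_real (fun i => (y i).natAbs) s hz hs h1 h2 q hq0
          rw [hzY] at this
          simp only [hgcd]
          exact mul_le_mul_of_nonneg_left this (by norm_num)
      _ = 4 * (∑ q ∈ (Finset.Ioc 0 T).filter (Fac (2 * Y.natAbs)), (q : ℝ) ^ (-(1 / 8) : ℝ)) * M := by
          rw [← Finset.mul_sum, ← Finset.sum_mul, mul_assoc]
      _ ≤ _ := by gcongr; exact hF _ T
  have hcard : (2 * Y.natAbs).primeFactors.card ≤ 1 + Y.natAbs.primeFactors.card := by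
    rw [Nat.primeFactors_mul (by norm_num) (Int.natAbs_ne_zero.2 hY0)]
    refine (Finset.card_union_le _ _).trans ?_
    rw [Nat.prime_two.primeFactors]; simp
  have hpow : K ^ (2 * Y.natAbs).primeFactors.card ≤ K * K ^ Y.natAbs.primeFactors.card := by
    refine (pow_le_pow_right₀ hK hcard).trans ?_
    rw [pow_add, pow_one]
  have hB0 : 0 ≤ C * (Y.natAbs : ℝ) ^ (1 / 64 : ℝ) := by positivity
  calc _ ≤ (4 * K ^ (2 * Y.natAbs).primeFactors.card * M) * (C * (Y.natAbs : ℝ) ^ (1 / 64 : ℝ)) :=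
        mul_le_mul_of_nonneg_right hsum hB0
    _ ≤ (4 * (K * K ^ Y.natAbs.primeFactors.card) * M) * (C * (Y.natAbs : ℝ) ^ (1 / 64 : ℝ)) := by
        gcongr
    _ = _ := by ring

lemma pow_omega_le (K η : ℝ) (hK : 1 ≤ K) (hη : 0 < η) : ∃ C : ℝ, 0 < C ∧ ∀ n : ℕ, n ≠ 0 →
    K ^ n.primeFactors.card ≤ C * (n : ℝ) ^ η := by
  set M : ℕ := ⌈K ^ η⁻¹⌉₊ with hM
  refine ⟨K ^ M, by positivity, fun n hn => ?_⟩
  have hle : ∀ p ∈ n.primeFactors, K ≤ (if p < M then K else 1) * (p : ℝ) ^ η := by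
    intro p hp
    have hp1 : (1 : ℝ) ≤ p := by exact_mod_cast (Nat.prime_of_mem_primeFactors hp).one_lt.le
    split_ifs with h
    · exact le_mul_of_one_le_right (by linarith) (Real.one_le_rpow hp1 hη.le)
    · rw [one_mul]
      have h1 : K ^ η⁻¹ ≤ p := (Nat.le_ceil _).trans (by exact_mod_cast not_lt.1 h)
      calc K = (K ^ η⁻¹) ^ η := by rw [← Real.rpow_mul (by linarith), inv_mul_cancel₀ hη.ne', Real.rpow_one]
        _ ≤ _ := Real.rpow_le_rpow (by positivity) h1 hη.le
  rw [← Finset.prod_const]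
  refine (Finset.prod_le_prod (fun _ _ => by linarith) hle).trans ?_
  rw [Finset.prod_mul_distrib]
  refine mul_le_mul ?_ ?_ (Finset.prod_nonneg fun _ _ => by positivity) (by positivity)
  · rw [Finset.prod_ite, Finset.prod_const, Finset.prod_const_one, mul_one]
    refine pow_le_pow_right₀ hK ?_
    calc _ ≤ (Finset.range M).card := Finset.card_le_card fun p hp => by
            simpa using (Finset.mem_filter.1 hp).2
      _ = M := Finset.card_range M
  · rw [Real.finsetProd_rpow _ _ fun _ _ => by positivity]
    refine Real.rpow_le_rpow (by positivity) ?_ hη.le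
    have := Nat.le_of_dvd (Nat.pos_of_ne_zero hn) (Nat.prod_primeFactors_dvd n)
    calc _ = ((∏ p ∈ n.primeFactors, p : ℕ) : ℝ) := by push_cast; rfl
      _ ≤ _ := by exact_mod_cast this

lemma card_div_sqf (n : ℕ) (hn : Squarefree n) : n.divisors.card ≤ 2 ^ n.primeFactors.card := by
  rw [Nat.card_divisors hn.ne_zero, ← Finset.prod_const]
  refine Finset.prod_le_prod' fun p _ => ?_
  have := hn.natFactorization_le_one p
  omega

/-- signed divisors -/
def sdiv (n : ℕ) : Finset ℤ :=
  (n.divisors.image fun d : ℕ => (d : ℤ)) ∪ (n.divisors.image fun d : ℕ => -(d : ℤ))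

lemma mem_sdiv (n : ℕ) (hn : n ≠ 0) (z : ℤ) (h : z.natAbs ∣ n) : z ∈ sdiv n := by
  unfold sdiv
  rw [Finset.mem_union, Finset.mem_image, Finset.mem_image]
  have hm : z.natAbs ∈ n.divisors := Nat.mem_divisors.2 ⟨h, hn⟩
  rcases Int.natAbs_eq z with h' | h'
  · exact Or.inl ⟨_, hm, h'.symm⟩
  · exact Or.inr ⟨_, hm, h'.symm⟩

lemma card_sdiv (n : ℕ) : (sdiv n).card ≤ 2 * n.divisors.card := by
  refine (Finset.card_union_le _ _).trans ?_
  have h1 := Finset.card_image_le (s := n.divisors) (f := fun d : ℕ => (d : ℤ))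
  have h2 := Finset.card_image_le (s := n.divisors) (f := fun d : ℕ => -(d : ℤ))
  omega

/-- the set of admissible `(r, s, y)` with radical `n`. -/
def TT (n : ℕ) : Finset ((Fin 4 → ℕ) × (Fin 4 → ℕ) × (Fin 4 → ℤ)) :=
  (Fintype.piFinset fun _ => n.divisors) ×ˢ (Fintype.piFinset fun _ => n.divisors) ×ˢ
    (Fintype.piFinset fun _ => sdiv n)

lemma card_TT (n : ℕ) (hn : Squarefree n) :
    ((TT n).card : ℝ) ≤ 16 * (2 ^ 12 : ℝ) ^ n.primeFactors.card := by
  have h : (TT n).card ≤ 16 * (2 ^ 12) ^ n.primeFactors.card := by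
    unfold TT
    rw [Finset.card_product, Finset.card_product, Fintype.card_piFinset, Fintype.card_piFinset]
    simp only [Finset.prod_const, Finset.card_univ, Fintype.card_fin]
    have h1 := card_div_sqf n hn
    have h2 := (card_sdiv n).trans (Nat.mul_le_mul_left 2 h1)
    calc _ ≤ (2 ^ n.primeFactors.card) ^ 4 * ((2 ^ n.primeFactors.card) ^ 4 * (2 * 2 ^ n.primeFactors.card) ^ 4) := by
          gcongr
      _ = _ := by rw [← pow_mul 2 12, mul_comm 12, pow_mul]; ring
  exact_mod_cast h

/-- majorant -/
noncomputable def vv (K : ℝ) (x : ℕ × ((Fin 4 → ℕ) × (Fin 4 → ℕ) × (Fin 4 → ℤ))) : ℝ :=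
  if Squarefree x.1 ∧ x.2 ∈ TT x.1 then K ^ x.1.primeFactors.card * (x.1 : ℝ) ^ (-(19 / 16) : ℝ) else 0

lemma vv_nonneg (K : ℝ) (hK : 1 ≤ K) : 0 ≤ vv K := by
  intro x
  show 0 ≤ vv K x
  unfold vv
  split_ifs
  · positivity
  · rfl

lemma summable_vv (K : ℝ) (hK : 1 ≤ K) : Summable (vv K) := by
  rw [summable_prod_of_nonneg (vv_nonneg K hK)]
  have hsupp : ∀ n, ∀ τ ∉ TT n, vv K (n, τ) = 0 := by
    intro n τ h
    unfold vv
    rw [if_neg (fun h' => h h'.2)]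
  refine ⟨fun n => summable_of_ne_finset_zero (s := TT n) (hsupp n), ?_⟩
  obtain ⟨C, hC, hc⟩ := pow_omega_le (K * 2 ^ 12) (1 / 16) (by linarith) (by norm_num)
  have hsum : Summable fun n : ℕ => 16 * C * (n : ℝ) ^ (-(9 / 8) : ℝ) := by
    refine Summable.mul_left _ ?_
    rw [Real.summable_nat_rpow]; norm_num
  refine Summable.of_nonneg_of_le (fun n => tsum_nonneg fun τ => vv_nonneg K hK _) (fun n => ?_) hsum
  rw [tsum_eq_sum (s := TT n) (hsupp n)]
  by_cases hn : Squarefree n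
  · have hn0 : (0 : ℝ) < n := by exact_mod_cast Nat.pos_of_ne_zero hn.ne_zero
    have : ∑ τ ∈ TT n, vv K (n, τ) = (TT n).card * (K ^ n.primeFactors.card * (n : ℝ) ^ (-(19 / 16) : ℝ)) := by
      rw [← nsmul_eq_mul, ← Finset.sum_const]
      refine Finset.sum_congr rfl fun τ hτ => ?_
      unfold vv
      rw [if_pos ⟨hn, hτ⟩]
    rw [this]
    calc _ ≤ (16 * (2 ^ 12 : ℝ) ^ n.primeFactors.card) * (K ^ n.primeFactors.card * (n : ℝ) ^ (-(19 / 16) : ℝ)) := by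
          gcongr; exact card_TT n hn
      _ = 16 * (K * 2 ^ 12) ^ n.primeFactors.card * (n : ℝ) ^ (-(19 / 16) : ℝ) := by rw [mul_pow K]; ring
      _ ≤ 16 * (C * (n : ℝ) ^ (1 / 16 : ℝ)) * (n : ℝ) ^ (-(19 / 16) : ℝ) := by
          gcongr; exact hc n hn.ne_zero
      _ = 16 * C * ((n : ℝ) ^ (1 / 16 : ℝ) * (n : ℝ) ^ (-(19 / 16) : ℝ)) := by ring
      _ = _ := by rw [← Real.rpow_add hn0]; norm_num
  · rw [Finset.sum_eq_zero]
    · positivity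
    · intro τ _
      unfold vv
      rw [if_neg (fun h => hn h.1)]

/-- full majorant -/
noncomputable def VV (K : ℝ) (x : ℕ × (ℕ × ((Fin 4 → ℕ) × (Fin 4 → ℕ) × (Fin 4 → ℤ)))) : ℝ :=
  (1 / (x.1 : ℝ) ^ 2) * vv K x.2

lemma summable_VV (K : ℝ) (hK : 1 ≤ K) : Summable (VV K) := by
  have hs : Summable fun n : ℕ => 1 / (n : ℝ) ^ 2 := Real.summable_one_div_nat_pow.2 (by norm_num)
  exact hs.mul_of_nonneg (summable_vv K hK) (fun _ => by positivity) (vv_nonneg K hK)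

/-- the embedding of the index set. -/
def iot (t : (Fin 4 → ℕ) × (Fin 4 → ℕ) × ℕ × (Fin 4 → ℤ)) :
    ℕ × (ℕ × ((Fin 4 → ℕ) × (Fin 4 → ℕ) × (Fin 4 → ℤ))) :=
  (t.2.2.1, radN (∏ i, t.2.2.2 i).natAbs, t.1, t.2.1, t.2.2.2)

lemma iot_inj : Function.Injective iot := by
  rintro ⟨r, s, s0, y⟩ ⟨r', s', s0', y'⟩ h
  simp only [iot, Prod.mk.injEq] at h
  obtain ⟨h1, -, h2, h3, h4⟩ := h
  subst h1; subst h2; subst h3; subst h4; rfl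

lemma sigma_bound : ∃ M : ℝ, 0 < M ∧ ∀ y : Fin 4 → ℤ, ‖sigmaInf fun i => Int.sign (y i)‖ ≤ M := by
  set P : Finset (Fin 4 → ℤ) := Fintype.piFinset fun _ => ({-1, 0, 1} : Finset ℤ) with hP
  have h0 : 0 ≤ ∑ e ∈ P, ‖sigmaInf e‖ := Finset.sum_nonneg fun _ _ => norm_nonneg _
  refine ⟨1 + ∑ e ∈ P, ‖sigmaInf e‖, by linarith, fun y => ?_⟩
  have hm : (fun i => Int.sign (y i)) ∈ P := by
    rw [hP, Fintype.mem_piFinset]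
    intro i
    rcases lt_trichotomy (y i) 0 with h | h | h
    · simp [Int.sign_eq_neg_one_of_neg h]
    · simp [h]
    · simp [Int.sign_eq_one_of_pos h]
  have := Finset.single_le_sum (f := fun e => ‖sigmaInf e‖) (fun _ _ => norm_nonneg _) hm
  linarith

lemma omega_abs_le (r s : Fin 4 → ℕ) (s0 : ℕ) : (omegaFn r s s0).natAbs ≤ 1 := by
  unfold omegaFn
  split_ifs with h
  · rw [Int.natAbs_mul]
    have h1 : (ArithmeticFunction.moebius s0).natAbs ≤ 1 := by
      have := ArithmeticFunction.abs_moebius_le_one (n := s0)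
      rw [Int.abs_eq_natAbs] at this
      omega
    have h2 : (∏ p ∈ ((∏ i, r i) * ∏ i, s i).primeFactors,
        (-1 : ℤ) ^ (((∏ i, r i) * ∏ i, s i).factorization p + 1)).natAbs = 1 := by
      rw [← Int.isUnit_iff_natAbs_eq]
      exact Finset.prod_induction _ IsUnit (fun _ _ => IsUnit.mul) isUnit_one
        fun p _ => (isUnit_one.neg).pow _
    rw [h2, mul_one]; exact h1
  · simp

lemma omega_ne_zero (r s : Fin 4 → ℕ) (s0 : ℕ) (h : omegaFn r s s0 ≠ 0) :
    (∀ i, Squarefree (r i)) ∧ (∀ i, Squarefree (s i)) ∧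
      Finset.univ.gcd s = 1 ∧ s0 ≠ 0 ∧
      ∀ p : ℕ, p.Prime → p ∣ (∏ i, r i) * ∏ i, s i → ∀ i, p ∣ r i * s i := by
  unfold omegaFn at h
  split_ifs at h with hc
  · refine ⟨hc.1, hc.2.1, hc.2.2.1, ?_, hc.2.2.2.2⟩
    rintro rfl
    simp at h
  · exact absurd rfl h

lemma E1abs_nonneg (D : ℝ) (Gv : (Fin 4 → ℕ) → (Fin 4 → ℤ) → ℂ) (t) : 0 ≤ E1abs D Gv t := by
  unfold E1abs
  split_ifs
  · positivity
  · rfl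

lemma norm_E1term (D : ℝ) (Gv : (Fin 4 → ℕ) → (Fin 4 → ℤ) → ℂ) (t) : ‖E1term D Gv t‖ = E1abs D Gv t := by
  unfold E1abs E1term
  split_ifs
  · rw [norm_div, norm_mul, norm_mul, Complex.norm_real, Real.norm_of_nonneg (by positivity)]
    congr 3
    rw [Complex.norm_intCast, Nat.cast_natAbs, Int.cast_abs]
  · simp

lemma term_bound : ∃ C K : ℝ, 0 < C ∧ 1 ≤ K ∧ ∀ (D : ℝ), 1 ≤ D →
    ∀ Gv : (Fin 4 → ℕ) → (Fin 4 → ℤ) → ℂ,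
      (∀ (s : Fin 4 → ℕ) (y : Fin 4 → ℤ),
        ¬ IsSquare (∏ i, (s i : ℤ) ^ 2 * y i ^ 3) →
          Filter.Tendsto (singularPartial fun i => (s i : ℤ) ^ 2 * y i ^ 3)
                Filter.atTop (nhds (Gv s y))) →
      ∀ t, E1abs D Gv t ≤ C * D ^ (-(1 : ℝ) / 4) * VV K (iot t) := by
  obtain ⟨C, K, hC, hK, hG⟩ := G_bound
  obtain ⟨M, hM, hσ⟩ := sigma_bound
  refine ⟨C * M, K, by positivity, hK, ?_⟩
  rintro D hD Gv hGv ⟨r, s, s0, y⟩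
  have hrhs : 0 ≤ C * M * D ^ (-(1 : ℝ) / 4) * VV K (iot (r, s, s0, y)) := by
    have : 0 ≤ VV K (iot (r, s, s0, y)) := mul_nonneg (by positivity) (vv_nonneg K hK _)
    positivity
  unfold E1abs
  simp only
  split_ifs with hc
  swap
  · exact hrhs
  obtain ⟨hy, hry, hsq, hDY⟩ := hc
  by_cases hω : omegaFn r s s0 = 0
  · rw [hω]; simpa using hrhs
  obtain ⟨w1, w2, w3, w4, w5⟩ := omega_ne_zero r s s0 hω
  have hrz : ∀ i, r i ∣ (y i).natAbs := fun i => Int.natCast_dvd.1 (hry i)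
  have h1 : ∀ p : ℕ, p.Prime → p ∣ ∏ i, s i → ∀ j, p ∣ s j * (y j).natAbs := by
    intro p hp hd j
    have := w5 p hp (hd.mul_left _) j
    rw [mul_comm]
    exact this.trans (mul_dvd_mul_right (hrz j) _)
  have h2 : ∀ p : ℕ, p.Prime → ¬ ∀ j, p ∣ s j := by
    intro p hp h
    have : p ∣ Finset.univ.gcd s := Finset.dvd_gcd fun j _ => h j
    rw [w3] at this
    exact hp.one_lt.ne' (Nat.dvd_one.1 this)
  have hY0 : ∏ i, y i ≠ 0 := by intro h; rw [h] at hsq; exact hsq (by simp)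
  have hYn := Int.natAbs_ne_zero.2 hY0
  have hg := hG s y (Gv s y) hsq hy w2 h1 h2 (hGv s y)
  have hzY : ∏ i, (y i).natAbs = (∏ i, y i).natAbs := by
    simp only [Fin.prod_univ_four, Int.natAbs_mul]
  have hS0 : ∏ i, s i ≠ 0 := Finset.prod_ne_zero_iff.2 fun i _ => (w2 i).ne_zero
  have hyd : ∀ i, (y i).natAbs ∣ (∏ i, y i).natAbs := fun i => by
    rw [← hzY]; exact Finset.dvd_prod_of_mem _ (Finset.mem_univ i)
  have dY : ∀ i, (y i).natAbs ∣ radN (∏ i, y i).natAbs := fun i =>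
    sqf_dvd_radN _ _ hYn (Int.squarefree_natAbs.2 (hy i)) fun p _ h => h.trans (hyd i)
  have dR : ∀ i, r i ∣ radN (∏ i, y i).natAbs := fun i => (hrz i).trans (dY i)
  have dS : ∀ i, s i ∣ radN (∏ i, y i).natAbs := fun i =>
    sqf_dvd_radN _ _ hYn (w2 i) fun p hp h => by
      have hd : p ∣ ∏ i, s i := h.trans (Finset.dvd_prod_of_mem _ (Finset.mem_univ i))
      have := h2 p hp
      push Not at this
      obtain ⟨j, hj⟩ := this
      exact ((hp.dvd_mul.1 (h1 p hp hd j)).resolve_left hj).trans (hyd j)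
  have hle4 : (∏ i, y i).natAbs ≤ radN (∏ i, y i).natAbs ^ 4 := by
    conv_lhs => rw [← hzY]
    calc ∏ i, (y i).natAbs ≤ ∏ _i : Fin 4, radN (∏ i, y i).natAbs :=
          Finset.prod_le_prod' fun i _ => Nat.le_of_dvd (radN_pos _) (dY i)
      _ = _ := by simp
  have hpf := radN_primeFactors (∏ i, y i).natAbs
  have hsf := radN_squarefree (∏ i, y i).natAbs
  have hn0 := radN_pos (∏ i, y i).natAbs
  have hV : VV K (iot (r, s, s0, y)) = (1 / (s0 : ℝ) ^ 2) *
      (K ^ (∏ i, y i).natAbs.primeFactors.card *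
        ((radN (∏ i, y i).natAbs : ℕ) : ℝ) ^ (-(19 / 16) : ℝ)) := by
    unfold VV vv iot
    simp only
    rw [if_pos, hpf]
    refine ⟨hsf, ?_⟩
    unfold TT
    simp only [Finset.mem_product, Fintype.mem_piFinset, Nat.mem_divisors]
    exact ⟨fun i => ⟨dR i, hn0.ne'⟩, fun i => ⟨dS i, hn0.ne'⟩, fun i => mem_sdiv _ hn0.ne' _ (dY i)⟩
  rw [hV]
  have hω0 : 0 ≤ ((omegaFn r s s0).natAbs : ℝ) := Nat.cast_nonneg _
  have hωle : ((omegaFn r s s0).natAbs : ℝ) ≤ 1 := by exact_mod_cast omega_abs_le r s s0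
  have hσy := hσ y
  have hS' : (0 : ℝ) < (∏ i, s i : ℕ) := by exact_mod_cast Nat.pos_of_ne_zero hS0
  have hs0' : (0 : ℝ) < s0 := by exact_mod_cast Nat.pos_of_ne_zero w4
  have hn' : (0 : ℝ) < (radN (∏ i, y i).natAbs : ℕ) := by exact_mod_cast hn0
  have hle4' : ((∏ i, y i).natAbs : ℝ) ≤ ((radN (∏ i, y i).natAbs : ℕ) : ℝ) ^ 4 := by exact_mod_cast hle4
  have hk0 : 0 ≤ K ^ (∏ i, y i).natAbs.primeFactors.card := by positivity
  have hZ' : (0 : ℝ) < (∏ i, y i).natAbs := by linarith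
  generalize K ^ (∏ i, y i).natAbs.primeFactors.card = κ at *
  generalize ((radN (∏ i, y i).natAbs : ℕ) : ℝ) = n at *
  generalize (((∏ i, y i).natAbs : ℕ) : ℝ) = Z at *
  generalize ((∏ i, s i : ℕ) : ℝ) = S at *
  generalize ‖sigmaInf fun i => Int.sign (y i)‖ = σ at *
  generalize ((omegaFn r s s0).natAbs : ℝ) = ω at *
  have hZ64 : Z ^ (1 / 64 : ℝ) ≤ n ^ (1 / 16 : ℝ) := by
    calc _ ≤ (n ^ 4) ^ (1 / 64 : ℝ) := Real.rpow_le_rpow hZ'.le hle4' (by norm_num)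
      _ = _ := by rw [← Real.rpow_natCast, ← Real.rpow_mul hn'.le]; norm_num
  have hD4 : Z ^ (-(1 : ℝ) / 4) ≤ D ^ (-(1 : ℝ) / 4) :=
    Real.rpow_le_rpow_of_nonpos (by linarith) hDY.le (by norm_num)
  have eZ : Z ^ (5 / 4 : ℝ) = Z ^ (-(1 : ℝ) / 4) * Z ^ ((3 : ℝ) / 2) := by
    rw [← Real.rpow_add hZ']; norm_num
  have en : n ^ (-(19 / 16) : ℝ) = n ^ (1 / 16 : ℝ) * n ^ (-(5 / 4) : ℝ) := by
    rw [← Real.rpow_add hn']; norm_num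
  have hnum : ω * ‖Gv s y‖ * σ ≤ 1 * (C * n ^ (1 / 16 : ℝ) * κ *
      (S * (D ^ (-(1 : ℝ) / 4) * Z ^ ((3 : ℝ) / 2)) * n ^ (-(5 / 4) : ℝ))) * M := by
    have hgg : ‖Gv s y‖ ≤ C * n ^ (1 / 16 : ℝ) * κ *
      (S * (D ^ (-(1 : ℝ) / 4) * Z ^ ((3 : ℝ) / 2)) * n ^ (-(5 / 4) : ℝ)) := by
      refine hg.trans ?_
      rw [eZ]
      gcongr
    have hgpos := norm_nonneg (Gv s y)
    have hpos2 := hgpos.trans hgg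
    calc ω * ‖Gv s y‖ * σ ≤ ω * ‖Gv s y‖ * M := by
          refine mul_le_mul_of_nonneg_left hσy (mul_nonneg hω0 hgpos)
      _ ≤ _ := by gcongr
  rw [div_le_iff₀ (by positivity), en]
  refine hnum.trans (le_of_eq ?_)
  field_simp

/-- Lemma 5.3: `E₁(D)` converges absolutely and is `O(D^{-1/4+ε})`. -/
theorem statement_17 (ε : ℝ) (hε : 0 < ε) :
    ∃ C : ℝ, 0 < C ∧
      ∀ (D : ℝ), 1 ≤ D →
        ∀ Gv : (Fin 4 → ℕ) → (Fin 4 → ℤ) → ℂ,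
          (∀ (s : Fin 4 → ℕ) (y : Fin 4 → ℤ),
              ¬ IsSquare (∏ i, (s i : ℤ) ^ 2 * y i ^ 3) →
              Filter.Tendsto (singularPartial fun i => (s i : ℤ) ^ 2 * y i ^ 3)
                Filter.atTop (nhds (Gv s y))) →
          Summable (E1abs D Gv) ∧
          (∑' t, E1abs D Gv t) ≤ C * D ^ (-(1 : ℝ) / 4 + ε) ∧
          ‖∑' t, E1term D Gv t‖ ≤ C * D ^ (-(1 : ℝ) / 4 + ε) := by
  obtain ⟨C, K, hC, hK, h⟩ := term_bound
  have hV := summable_VV K hK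
  have hV0 : ∀ x, 0 ≤ VV K x := fun x => mul_nonneg (by positivity) (vv_nonneg K hK _)
  have hT0 : 0 ≤ ∑' x, VV K x := tsum_nonneg hV0
  refine ⟨C * (1 + ∑' x, VV K x), by positivity, fun D hD Gv hGv => ?_⟩
  have hb := h D hD Gv hGv
  have hVi : Summable fun t => VV K (iot t) := hV.comp_injective iot_inj
  have hmaj : Summable fun t => C * D ^ (-(1 : ℝ) / 4) * VV K (iot t) := hVi.mul_left _
  have hsum : Summable (E1abs D Gv) := Summable.of_nonneg_of_le (E1abs_nonneg D Gv) hb hmaj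
  have hD0 : 0 < D := by linarith
  have hle : (∑' t, E1abs D Gv t) ≤ C * (1 + ∑' x, VV K x) * D ^ (-(1 : ℝ) / 4 + ε) := by
    calc (∑' t, E1abs D Gv t) ≤ ∑' t, C * D ^ (-(1 : ℝ) / 4) * VV K (iot t) := hsum.tsum_le_tsum hb hmaj
      _ = C * D ^ (-(1 : ℝ) / 4) * ∑' t, VV K (iot t) := tsum_mul_left
      _ ≤ C * D ^ (-(1 : ℝ) / 4) * (1 + ∑' x, VV K x) := by
          gcongr
          have := tsum_comp_le_tsum_of_inj hV hV0 iot_inj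
          simp only [Function.comp_def] at this
          linarith
      _ = C * (1 + ∑' x, VV K x) * D ^ (-(1 : ℝ) / 4) := by ring
      _ ≤ _ := by
          have : D ^ (-(1 : ℝ) / 4) ≤ D ^ (-(1 : ℝ) / 4 + ε) :=
            Real.rpow_le_rpow_of_exponent_le hD (by linarith)
          gcongr
  refine ⟨hsum, hle, le_trans ?_ hle⟩
  have hn : (fun t => ‖E1term D Gv t‖) = E1abs D Gv := funext fun t => norm_E1term D Gv t
  have := norm_tsum_le_tsum_norm (f := E1term D Gv) (by rw [hn]; exact hsum)
  simpa only [norm_E1term] using this
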